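/- arXiv:math/9905167 — 5 statements merged into one kernel-verified Lean document; each statement's English description precedes it below -/
import Mathlib

section
/- Let Δ be a closed convex subset of a CAT(κ) space X̂ and let π : Ŷ → X̂ be a simple branched cover of X̂ over Δ; if κ > 0, assume additionally Diam(X̂) < π/(2√κ) and Diam(Ŷ) < 2π/(3√κ). Then any path in Ŷ that projects under π to a geodesic of X̂ is itself a geodesic of Ŷ, and it is the unique geodesic of Ŷ with its endpoints. (Lemma 3.2(ii)) -/
open Set Metric
open scoped ENNReal

noncomputable section

/-- A path in a metric space: a continuous map defined on a compact interval `[a, b]`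
(with `a ≤ b`). -/
structure MPath (X : Type*) [MetricSpace X] where
  a : ℝ
  b : ℝ
  hab : a ≤ b
  toFun : ℝ → X
  cont : ContinuousOn toFun (Set.Icc a b)

namespace MPath

variable {X : Type*} [MetricSpace X]

/-- The length of a path: the total variation of the map on `[a, b]`. -/
def length (γ : MPath X) : ℝ≥0∞ := eVariationOn γ.toFun (Set.Icc γ.a γ.b)

/-- The initial endpoint of a path. -/
def initial (γ : MPath X) : X := γ.toFun γ.a

/-- The final endpoint of a path. -/
def final (γ : MPath X) : X := γ.toFun γ.b

end MPath

/-- A geodesic in a metric space: a map on `[a, b]` with `dist (γ s) (γ t) = |s - t|`.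
(Such a map is automatically a continuous path.) -/
structure GeodesicIn (X : Type*) [MetricSpace X] where
  a : ℝ
  b : ℝ
  hab : a ≤ b
  toFun : ℝ → X
  isom : ∀ s ∈ Set.Icc a b, ∀ t ∈ Set.Icc a b, dist (toFun s) (toFun t) = |s - t|

namespace GeodesicIn

variable {X : Type*} [MetricSpace X]

/-- The initial endpoint of a geodesic. -/
def initial (γ : GeodesicIn X) : X := γ.toFun γ.a

/-- The final endpoint of a geodesic. -/
def final (γ : GeodesicIn X) : X := γ.toFun γ.b

/-- The length of a geodesic. -/
def length (γ : GeodesicIn X) : ℝ := γ.b - γ.a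

end GeodesicIn

/-- A metric space is geodesic if any two points are joined by a geodesic. -/
def IsGeodesicSpace (X : Type*) [MetricSpace X] : Prop :=
  ∀ x y : X, ∃ γ : GeodesicIn X, γ.initial = x ∧ γ.final = y

/-- Inverse hyperbolic cosine. -/
def arcoshReal (x : ℝ) : ℝ := Real.log (x + Real.sqrt (x ^ 2 - 1))

/-- The angle at a vertex of a triangle in the model space `M_κ²` whose two adjacent sides
have lengths `a`, `b` and whose opposite side has length `c`, computed by the appropriate
(euclidean, hyperbolic or spherical) law of cosines. -/
def modelAngle (κ a b c : ℝ) : ℝ :=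
  if κ = 0 then Real.arccos ((a ^ 2 + b ^ 2 - c ^ 2) / (2 * a * b))
  else if κ < 0 then
    Real.arccos
      ((Real.cosh (Real.sqrt (-κ) * a) * Real.cosh (Real.sqrt (-κ) * b) -
          Real.cosh (Real.sqrt (-κ) * c)) /
        (Real.sinh (Real.sqrt (-κ) * a) * Real.sinh (Real.sqrt (-κ) * b)))
  else
    Real.arccos
      ((Real.cos (Real.sqrt κ * c) - Real.cos (Real.sqrt κ * a) * Real.cos (Real.sqrt κ * b)) /
        (Real.sin (Real.sqrt κ * a) * Real.sin (Real.sqrt κ * b)))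

/-- The distance in the model space `M_κ²` between two points lying at distances `s` and `t`
from a common vertex, along two geodesics making an angle `θ` at that vertex, computed by the
appropriate law of cosines. -/
def modelDistFromVertex (κ s t θ : ℝ) : ℝ :=
  if κ = 0 then Real.sqrt (s ^ 2 + t ^ 2 - 2 * s * t * Real.cos θ)
  else if κ < 0 then
    (1 / Real.sqrt (-κ)) *
      arcoshReal (Real.cosh (Real.sqrt (-κ) * s) * Real.cosh (Real.sqrt (-κ) * t) -
        Real.sinh (Real.sqrt (-κ) * s) * Real.sinh (Real.sqrt (-κ) * t) * Real.cos θ)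
  else
    (1 / Real.sqrt κ) *
      Real.arccos (Real.cos (Real.sqrt κ * s) * Real.cos (Real.sqrt κ * t) +
        Real.sin (Real.sqrt κ * s) * Real.sin (Real.sqrt κ * t) * Real.cos θ)

/-- A (geodesic) triangle in a metric space: three geodesics, the final endpoint of each being
the initial endpoint of the next (indices mod 3). -/
structure TriangleIn (X : Type*) [MetricSpace X] where
  edge : Fin 3 → GeodesicIn X
  compat : ∀ i : Fin 3, (edge i).final = (edge (i + 1)).initial

namespace TriangleIn

variable {X : Type*} [MetricSpace X]

/-- The perimeter of a triangle. -/
def perimeter (T : TriangleIn X) : ℝ := ∑ i, (T.edge i).length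

/-- The distance, in a comparison triangle for `T` in the model space `M_κ²`, between the
points corresponding to the point of parameter `s` on edge `i` and the point of parameter `t`
on edge `j`.  (Any two edges of a triangle share a vertex, and the comparison distance is
computed via the model-space law of cosines at the corresponding shared vertex.) -/
def cmpDist (κ : ℝ) (T : TriangleIn X) (i j : Fin 3) (s t : ℝ) : ℝ :=
  if i = j then |s - t|
  else if j = i + 1 then
    modelDistFromVertex κ ((T.edge i).b - s) (t - (T.edge j).a)
      (modelAngle κ (T.edge i).length (T.edge j).length (T.edge (i + 2)).length)
  else
    modelDistFromVertex κ (s - (T.edge i).a) ((T.edge j).b - t)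
      (modelAngle κ (T.edge i).length (T.edge j).length (T.edge (i + 1)).length)

/-- A triangle satisfies CAT(κ) if its perimeter is `< 2π/√κ` (no condition when `κ ≤ 0`)
and each distance between points on two of its edges is at most the distance between the
corresponding points of a comparison triangle in `M_κ²`. -/
def SatisfiesCAT (κ : ℝ) (T : TriangleIn X) : Prop :=
  (0 < κ → T.perimeter < 2 * Real.pi / Real.sqrt κ) ∧
    ∀ i j : Fin 3, ∀ s ∈ Set.Icc (T.edge i).a (T.edge i).b,
      ∀ t ∈ Set.Icc (T.edge j).a (T.edge j).b,
        dist ((T.edge i).toFun s) ((T.edge j).toFun t) ≤ T.cmpDist κ i j s t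

end TriangleIn

/-- A metric space is CAT(κ) if it is geodesic and every triangle of perimeter `< 2π/√κ`
(every triangle, when `κ ≤ 0`) satisfies the CAT(κ) comparison inequality. -/
def IsCATSpace (κ : ℝ) (X : Type*) [MetricSpace X] : Prop :=
  IsGeodesicSpace X ∧
    ∀ T : TriangleIn X, (0 < κ → T.perimeter < 2 * Real.pi / Real.sqrt κ) → T.SatisfiesCAT κ

/-- `A` is a convex subset of the subspace `V`: any two points of `A` are joined by a geodesic
lying in `V`, and every geodesic lying in `V` joining two points of `A` lies in `A`. -/
def IsConvexIn {X : Type*} [MetricSpace X] (V A : Set X) : Prop :=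
  ∀ x ∈ A, ∀ y ∈ A,
    (∃ γ : GeodesicIn X, γ.initial = x ∧ γ.final = y ∧ ∀ t ∈ Set.Icc γ.a γ.b, γ.toFun t ∈ V) ∧
      ∀ γ : GeodesicIn X, γ.initial = x → γ.final = y →
        (∀ t ∈ Set.Icc γ.a γ.b, γ.toFun t ∈ V) → ∀ t ∈ Set.Icc γ.a γ.b, γ.toFun t ∈ A

/-- A convex subset of a metric space: any two of its points are joined by a geodesic of the
ambient space, and every such geodesic lies in the subset. -/
def IsConvexSubset {X : Type*} [MetricSpace X] (A : Set X) : Prop :=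
  IsConvexIn Set.univ A

/-- A metric space has curvature `≤ κ` (is locally CAT(κ)) if each point has a convex CAT(κ)
neighborhood. -/
def HasCurvatureLE (κ : ℝ) (X : Type*) [MetricSpace X] : Prop :=
  ∀ x : X, ∃ V : Set X, V ∈ nhds x ∧ IsConvexSubset V ∧ IsCATSpace κ ↥V

/-- A metric space is a length space if any two points are joined by paths of length
arbitrarily close to the distance between them. -/
def IsLengthSpace (X : Type*) [MetricSpace X] : Prop :=
  ∀ x y : X, ∀ ε : ℝ, 0 < ε →
    ∃ γ : MPath X, γ.initial = x ∧ γ.final = y ∧ γ.length < ENNReal.ofReal (dist x y + ε)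

/-- The induced path (pseudo)distance on the subset `S`: the infimum of the lengths of paths
joining `x` and `y` inside `S`. -/
def pathDistIn {X : Type*} [MetricSpace X] (S : Set X) (x y : X) : ℝ≥0∞ :=
  ⨅ (γ : MPath X) (_ : γ.initial = x) (_ : γ.final = y)
    (_ : ∀ t ∈ Set.Icc γ.a γ.b, γ.toFun t ∈ S), γ.length

/-- `π : Y → X` is a simple branched cover of `X` over `Δ ⊆ X`: `X` and `Y` are length
spaces, the restriction of `π` over the complement of `Δ` is a locally isometric covering
map onto `X − Δ`, and `π` preserves distances from points of `π⁻¹(Δ)`. -/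
structure IsSimpleBranchedCover {Y X : Type*} [MetricSpace Y] [MetricSpace X]
    (π : Y → X) (Δ : Set X) : Prop where
  base_lengthSpace : IsLengthSpace X
  total_lengthSpace : IsLengthSpace Y
  covering : IsCoveringMap fun y : {y : Y // π y ∉ Δ} => (⟨π y.1, y.2⟩ : {x : X // x ∉ Δ})
  covering_surj :
    Function.Surjective fun y : {y : Y // π y ∉ Δ} => (⟨π y.1, y.2⟩ : {x : X // x ∉ Δ})
  locally_isometric : ∀ y : Y, π y ∉ Δ → ∃ ε > 0, ∀ u v : Y, π u ∉ Δ → π v ∉ Δ →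
    dist u y < ε → dist v y < ε → dist (π u) (π v) = dist u v
  dist_eq : ∀ y z : Y, π y ∈ Δ ∨ π z ∈ Δ → dist y z = dist (π y) (π z)

/-- The restriction of a map `π : Y → X` to a subset `V ⊆ Y`, viewed as a map onto its
image. -/
def restrictToImage {Y X : Type*} (π : Y → X) (V : Set Y) : ↥V → ↥(π '' V) :=
  fun v => ⟨π v.1, ⟨v.1, v.2, rfl⟩⟩

end

/-- A transitive relation on a compact interval that holds locally holds between the endpoints. -/
lemma rel_endpoints_of_local {a b : ℝ} (hab : a ≤ b) {P : ℝ → ℝ → Prop}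
    (htrans : ∀ s ∈ Icc a b, ∀ t ∈ Icc a b, ∀ u ∈ Icc a b, s ≤ t → t ≤ u →
      P s t → P t u → P s u)
    (hloc : ∀ x ∈ Icc a b, ∃ ε > 0, ∀ s ∈ Icc a b, ∀ t ∈ Icc a b, s ≤ t →
      |s - x| < ε → |t - x| < ε → P s t) : P a b := by
  have hloc' : ∀ x : Icc a b, ∃ ε > 0, ∀ s ∈ Icc a b, ∀ t ∈ Icc a b, s ≤ t →
      |s - x| < ε → |t - x| < ε → P s t := fun x => hloc x x.2
  choose ε hε hP using hloc'
  obtain ⟨t, ht0, hmono, ⟨m, hm⟩, hsub⟩ := exists_monotone_Icc_subset_open_cover_Icc hab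
    (c := fun x : Icc a b => ball x (ε x)) (fun x => isOpen_ball)
    (fun x _ => mem_iUnion.2 ⟨x, mem_ball_self (hε x)⟩)
  have hstep : ∀ n, P (t n) (t (n + 1)) := by
    intro n
    obtain ⟨i, hi⟩ := hsub n
    have hle := hmono (Nat.le_succ n)
    have h1 : t n ∈ ball i (ε i) := hi (left_mem_Icc.2 hle)
    have h2 : t (n + 1) ∈ ball i (ε i) := hi (right_mem_Icc.2 hle)
    exact hP i _ (t n).2 _ (t (n + 1)).2 hle h1 h2
  have hind : ∀ n, P a (t n) := by
    intro n
    induction n with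
    | zero =>
      have ha : a ∈ Icc a b := left_mem_Icc.2 hab
      rw [ht0]
      exact hP ⟨a, ha⟩ a ha a ha le_rfl (by simpa using hε _) (by simpa using hε _)
    | succ n ih =>
      exact htrans a (left_mem_Icc.2 hab) _ (t n).2 _ (t (n + 1)).2 (t n).2.1
        (hmono (Nat.le_succ n)) ih (hstep n)
  have hb : (t m : ℝ) = b := by rw [hm m le_rfl]
  exact hb ▸ hind m

lemma modelAngle_of_add_eq {κ s t : ℝ} (hs : 0 < s) (ht : 0 < t)
    (h : 0 < κ → t + s < Real.pi / Real.sqrt κ) : modelAngle κ (t + s) s t = 0 := by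
  unfold modelAngle
  split_ifs with h0 h1
  · refine (congrArg Real.arccos ?_).trans Real.arccos_one
    field_simp
    ring
  · have hk : 0 < Real.sqrt (-κ) := Real.sqrt_pos.2 (by linarith)
    have hsinh : 0 < Real.sinh (Real.sqrt (-κ) * (t + s)) * Real.sinh (Real.sqrt (-κ) * s) :=
      mul_pos (Real.sinh_pos_iff.2 (by positivity)) (Real.sinh_pos_iff.2 (by positivity))
    refine (congrArg Real.arccos ?_).trans Real.arccos_one
    rw [div_eq_one_iff_eq hsinh.ne',
      show Real.sqrt (-κ) * t = Real.sqrt (-κ) * (t + s) - Real.sqrt (-κ) * s by ring,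
      Real.cosh_sub]
    ring
  · have hκ : 0 < κ := lt_of_le_of_ne (not_lt.1 h1) (Ne.symm h0)
    have hk : 0 < Real.sqrt κ := Real.sqrt_pos.2 hκ
    have hlt : Real.sqrt κ * (t + s) < Real.pi := by
      rw [mul_comm]
      exact (lt_div_iff₀ hk).1 (h hκ)
    have hpos : 0 < Real.sqrt κ * t := by positivity
    have hsin : 0 < Real.sin (Real.sqrt κ * (t + s)) * Real.sin (Real.sqrt κ * s) :=
      mul_pos (Real.sin_pos_of_pos_of_lt_pi (by positivity) hlt)
        (Real.sin_pos_of_pos_of_lt_pi (by positivity) (by linarith))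
    refine (congrArg Real.arccos ?_).trans Real.arccos_one
    rw [div_eq_one_iff_eq hsin.ne',
      show Real.sqrt κ * t = Real.sqrt κ * (t + s) - Real.sqrt κ * s by ring, Real.cos_sub]
    ring

lemma modelDistFromVertex_self_zero (κ s : ℝ) : modelDistFromVertex κ s s 0 = 0 := by
  unfold modelDistFromVertex
  simp only [Real.cos_zero, mul_one]
  split_ifs with h0 h1
  · rw [show s ^ 2 + s ^ 2 - 2 * s * s = 0 by ring, Real.sqrt_zero]
  · rw [← sq, ← sq, Real.cosh_sq_sub_sinh_sq]
    simp [arcoshReal]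
  · rw [← sq, ← sq, Real.cos_sq_add_sin_sq, Real.arccos_one, mul_zero]

/-- Geodesics of length `< π/√κ` in a CAT(κ) space are determined by their endpoints. -/
lemma IsCATSpace.eqOn_of_endpoints_eq {X : Type*} [MetricSpace X] {κ : ℝ} (hX : IsCATSpace κ X)
    {f g : ℝ → X} {L : ℝ}
    (hf : ∀ s ∈ Icc 0 L, ∀ t ∈ Icc 0 L, dist (f s) (f t) = |s - t|)
    (hg : ∀ s ∈ Icc 0 L, ∀ t ∈ Icc 0 L, dist (g s) (g t) = |s - t|)
    (h0 : f 0 = g 0) (h1 : f L = g L) (hL : 0 < κ → L < Real.pi / Real.sqrt κ) :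
    EqOn f g (Icc 0 L) := by
  intro t ht
  rcases ht.1.eq_or_lt with rfl | ht0
  · exact h0
  rcases ht.2.eq_or_lt with rfl | htL
  · exact h1
  let T : TriangleIn X :=
    { edge := ![⟨0, L, ht.1.trans ht.2, f, hf⟩,
        ⟨0, L - t, by linarith, fun u => g (L - u), fun u hu v hv => by
          rw [hg _ ⟨by linarith [hu.2], by linarith [hu.1]⟩ _
            ⟨by linarith [hv.2], by linarith [hv.1]⟩, abs_sub_comm]
          congr 1; ring⟩,
        ⟨0, t, ht.1, fun u => g (t - u), fun u hu v hv => by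
          rw [hg _ ⟨by linarith [hu.2], by linarith [hu.1]⟩ _
            ⟨by linarith [hv.2], by linarith [hv.1]⟩, abs_sub_comm]
          congr 1; ring⟩]
      compat := by
        intro i
        fin_cases i <;> simp [GeodesicIn.initial, GeodesicIn.final, h0, h1] }
  have hper : 0 < κ → T.perimeter < 2 * Real.pi / Real.sqrt κ := by
    intro hκ
    have hT : T.perimeter = 2 * L := by
      simp [TriangleIn.perimeter, Fin.sum_univ_three, T, GeodesicIn.length]
      ring
    rw [hT, mul_div_assoc]
    linarith [hL hκ]
  have hcmp := (hX.2 T hper).2 0 1 t ht (L - t) ⟨by simp [T]; linarith, le_rfl⟩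
  have hdist : T.cmpDist κ 0 1 t (L - t) = 0 := by
    have hang := modelAngle_of_add_eq (κ := κ) (s := L - t) (t := t) (by linarith) ht0
      (by simpa using hL)
    rw [add_sub_cancel] at hang
    simp [TriangleIn.cmpDist, T, GeodesicIn.length, hang, modelDistFromVertex_self_zero]
  rw [hdist] at hcmp
  simpa [T] using hcmp

namespace IsSimpleBranchedCover

variable {X Y : Type*} [MetricSpace X] [MetricSpace Y] {π : Y → X} {Δ : Set X}

lemma exists_dist_eq_near (hπ : IsSimpleBranchedCover π Δ) {y : Y} (hy : π y ∉ Δ) :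
    ∃ ε > 0, ∀ u v : Y, dist u y < ε → dist v y < ε → dist (π u) (π v) = dist u v := by
  obtain ⟨ε, hε, h⟩ := hπ.locally_isometric y hy
  refine ⟨ε, hε, fun u v hu hv => ?_⟩
  by_cases huv : π u ∈ Δ ∨ π v ∈ Δ
  · exact (hπ.dist_eq u v huv).symm
  · rw [not_or] at huv
    exact h u v huv.1 huv.2 hu hv

lemma exists_dist_eq_near_of_continuousOn (hπ : IsSimpleBranchedCover π Δ) {σ : ℝ → Y}
    {s : Set ℝ} (hσ : ContinuousOn σ s) {x : ℝ} (hx : x ∈ s) (hxΔ : π (σ x) ∉ Δ) :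
    ∃ ε > 0, ∀ u ∈ s, ∀ v ∈ s, |u - x| < ε → |v - x| < ε →
      dist (π (σ u)) (π (σ v)) = dist (σ u) (σ v) := by
  obtain ⟨ε, hε, h⟩ := hπ.exists_dist_eq_near hxΔ
  obtain ⟨η, hη, hση⟩ := Metric.continuousOn_iff.1 hσ x hx ε hε
  exact ⟨η, hη, fun u hu v hv hux hvx => h _ _ (hση u hu hux) (hση v hv hvx)⟩

lemma edist_map_endpoints_le_length (hπ : IsSimpleBranchedCover π Δ) (σ : MPath Y) :
    edist (π σ.initial) (π σ.final) ≤ σ.length := by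
  have hadd : ∀ s t u : ℝ, s ≤ t → t ≤ u →
      eVariationOn σ.toFun (Icc s t) + eVariationOn σ.toFun (Icc t u) =
        eVariationOn σ.toFun (Icc s u) := fun s t u hst htu => by
    simpa using eVariationOn.Icc_add_Icc σ.toFun (s := univ) hst htu (mem_univ _)
  by_cases hΔ : ∃ t ∈ Icc σ.a σ.b, π (σ.toFun t) ∈ Δ
  · obtain ⟨t, ht, htΔ⟩ := hΔ
    have e1 : edist (π σ.initial) (π (σ.toFun t)) = edist σ.initial (σ.toFun t) := by
      rw [edist_dist, edist_dist, hπ.dist_eq _ _ (Or.inr htΔ)]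
    have e2 : edist (π (σ.toFun t)) (π σ.final) = edist (σ.toFun t) σ.final := by
      rw [edist_dist, edist_dist, hπ.dist_eq _ _ (Or.inl htΔ)]
    refine (edist_triangle _ (π (σ.toFun t)) _).trans ?_
    rw [e1, e2, MPath.length, ← hadd _ _ _ ht.1 ht.2]
    exact add_le_add
      (eVariationOn.edist_le _ (left_mem_Icc.2 ht.1) (right_mem_Icc.2 ht.1))
      (eVariationOn.edist_le _ (left_mem_Icc.2 ht.2) (right_mem_Icc.2 ht.2))
  · push Not at hΔ
    refine rel_endpoints_of_local σ.hab (P := fun s t =>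
      edist (π (σ.toFun s)) (π (σ.toFun t)) ≤ eVariationOn σ.toFun (Icc s t)) ?_ ?_
    · intro s _ t _ u _ hst htu h1 h2
      refine (edist_triangle _ (π (σ.toFun t)) _).trans ?_
      rw [← hadd _ _ _ hst htu]
      exact add_le_add h1 h2
    · intro x hx
      obtain ⟨ε, hε, h⟩ := hπ.exists_dist_eq_near_of_continuousOn σ.cont hx (hΔ x hx)
      refine ⟨ε, hε, fun s hs t ht hst hsx htx => ?_⟩
      rw [edist_dist, h s hs t ht hsx htx, ← edist_dist]
      exact eVariationOn.edist_le _ (left_mem_Icc.2 hst) (right_mem_Icc.2 hst)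

/-- A simple branched cover does not increase distances. -/
lemma dist_map_le (hπ : IsSimpleBranchedCover π Δ) (y z : Y) : dist (π y) (π z) ≤ dist y z := by
  refine le_of_forall_pos_le_add fun ε hε => ?_
  obtain ⟨σ, rfl, rfl, hσ⟩ := hπ.total_lengthSpace y z ε hε
  have h := (hπ.edist_map_endpoints_le_length σ).trans hσ.le
  rw [edist_dist] at h
  exact (ENNReal.ofReal_le_ofReal_iff (by positivity)).1 h

/-- A lift of a geodesic to a simple branched cover is a geodesic. -/
lemma dist_lift_eq (hπ : IsSimpleBranchedCover π Δ) {σ : ℝ → Y} {a b : ℝ}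
    (hσ : ContinuousOn σ (Icc a b))
    (hgeod : ∀ s ∈ Icc a b, ∀ t ∈ Icc a b, dist (π (σ s)) (π (σ t)) = |s - t|) :
    ∀ s ∈ Icc a b, ∀ t ∈ Icc a b, dist (σ s) (σ t) = |s - t| := by
  intro s hs t ht
  wlog hst : s ≤ t generalizing s t
  · rw [dist_comm, abs_sub_comm, this t ht s hs (le_of_not_ge hst)]
  refine le_antisymm ?_ (hgeod s hs t ht ▸ hπ.dist_map_le _ _)
  rw [abs_sub_comm, abs_of_nonneg (sub_nonneg.2 hst)]
  have hsub : Icc s t ⊆ Icc a b := Icc_subset_Icc hs.1 ht.2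
  by_cases hΔ : ∃ u ∈ Icc s t, π (σ u) ∈ Δ
  · obtain ⟨u, hu, huΔ⟩ := hΔ
    refine (dist_triangle _ (σ u) _).trans_eq ?_
    rw [hπ.dist_eq _ _ (Or.inr huΔ), hπ.dist_eq _ _ (Or.inl huΔ), hgeod _ hs _ (hsub hu),
      hgeod _ (hsub hu) _ ht, abs_sub_comm, abs_of_nonneg (sub_nonneg.2 hu.1), abs_sub_comm,
      abs_of_nonneg (sub_nonneg.2 hu.2)]
    ring
  · push Not at hΔ
    refine rel_endpoints_of_local hst (P := fun p q => dist (σ p) (σ q) ≤ q - p) ?_ ?_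
    · intro p _ q _ r _ _ _ h1 h2
      linarith [dist_triangle (σ p) (σ q) (σ r)]
    · intro x hx
      obtain ⟨ε, hε, h⟩ :=
        hπ.exists_dist_eq_near_of_continuousOn (hσ.mono hsub) hx (hΔ x hx)
      refine ⟨ε, hε, fun p hp q hq hpq hpx hqx => ?_⟩
      rw [← h p hp q hq hpx hqx, hgeod _ (hsub hp) _ (hsub hq), abs_sub_comm,
        abs_of_nonneg (sub_nonneg.2 hpq)]

/-- Two lifts of a path avoiding the branch locus agree at one endpoint if and only if they agree
at the other. -/
lemma lift_eq_left_iff_right (hπ : IsSimpleBranchedCover π Δ) {σ τ : ℝ → Y} {a b : ℝ}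
    (hab : a ≤ b) (hσ : ContinuousOn σ (Icc a b)) (hτ : ContinuousOn τ (Icc a b))
    (hproj : ∀ t ∈ Icc a b, π (σ t) = π (τ t)) (hΔ : ∀ t ∈ Icc a b, π (σ t) ∉ Δ) :
    σ a = τ a ↔ σ b = τ b := by
  refine rel_endpoints_of_local hab (P := fun s t => σ s = τ s ↔ σ t = τ t)
    (fun s _ t _ u _ _ _ h1 h2 => h1.trans h2) fun x hx => ?_
  suffices h : ∃ ε > 0, ∀ s ∈ Icc a b, |s - x| < ε → (σ s = τ s ↔ σ x = τ x) by
    obtain ⟨ε, hε, h⟩ := h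
    exact ⟨ε, hε, fun s hs t ht _ hsx htx => (h s hs hsx).trans (h t ht htx).symm⟩
  by_cases hx' : σ x = τ x
  · obtain ⟨ε, hε, h⟩ := hπ.exists_dist_eq_near (hΔ x hx)
    obtain ⟨η₁, hη₁, h₁⟩ := Metric.continuousOn_iff.1 hσ x hx ε hε
    obtain ⟨η₂, hη₂, h₂⟩ := Metric.continuousOn_iff.1 hτ x hx ε hε
    refine ⟨min η₁ η₂, lt_min hη₁ hη₂, fun s hs hsx => iff_of_true ?_ hx'⟩
    have hd := h (σ s) (τ s) (h₁ s hs (hsx.trans_le (min_le_left _ _)))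
      (hx' ▸ h₂ s hs (hsx.trans_le (min_le_right _ _)))
    rwa [hproj s hs, dist_self, eq_comm, dist_eq_zero] at hd
  · have hpos : 0 < dist (σ x) (τ x) / 2 := half_pos (dist_pos.2 hx')
    obtain ⟨η₁, hη₁, h₁⟩ := Metric.continuousOn_iff.1 hσ x hx _ hpos
    obtain ⟨η₂, hη₂, h₂⟩ := Metric.continuousOn_iff.1 hτ x hx _ hpos
    refine ⟨min η₁ η₂, lt_min hη₁ hη₂, fun s hs hsx => iff_of_false (fun heq => ?_) hx'⟩
    have d₁ := h₁ s hs (hsx.trans_le (min_le_left _ _))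
    have d₂ := h₂ s hs (hsx.trans_le (min_le_right _ _))
    rw [← heq] at d₂
    linarith [dist_triangle_left (σ x) (τ x) (σ s)]

/-- Two lifts of a geodesic with the same endpoints agree when the branch locus is convex. -/
lemma eqOn_lifts_of_endpoints_eq (hπ : IsSimpleBranchedCover π Δ) (hΔ : IsConvexSubset Δ)
    {σ τ : ℝ → Y} {a b : ℝ} (hσ : ContinuousOn σ (Icc a b)) (hτ : ContinuousOn τ (Icc a b))
    (hproj : ∀ t ∈ Icc a b, π (σ t) = π (τ t))
    (hgeod : ∀ s ∈ Icc a b, ∀ t ∈ Icc a b, dist (π (σ s)) (π (σ t)) = |s - t|)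
    (ha : σ a = τ a) (hb : σ b = τ b) : EqOn σ τ (Icc a b) := by
  intro t ht
  by_cases htΔ : π (σ t) ∈ Δ
  · rw [← dist_eq_zero, hπ.dist_eq _ _ (Or.inl htΔ), hproj t ht, dist_self]
  have hleft : Icc a t ⊆ Icc a b := Icc_subset_Icc_right ht.2
  have hright : Icc t b ⊆ Icc a b := Icc_subset_Icc_left ht.1
  by_cases h₁ : ∀ s ∈ Icc a t, π (σ s) ∉ Δ
  · exact (hπ.lift_eq_left_iff_right ht.1 (hσ.mono hleft) (hτ.mono hleft)
      (fun s hs => hproj s (hleft hs)) h₁).1 ha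
  by_cases h₂ : ∀ s ∈ Icc t b, π (σ s) ∉ Δ
  · exact (hπ.lift_eq_left_iff_right ht.2 (hσ.mono hright) (hτ.mono hright)
      (fun s hs => hproj s (hright hs)) h₂).2 hb
  push Not at h₁ h₂
  obtain ⟨p, hp, hpΔ⟩ := h₁
  obtain ⟨q, hq, hqΔ⟩ := h₂
  have hpq : Icc p q ⊆ Icc a b := Icc_subset_Icc hp.1 hq.2
  exact absurd ((hΔ _ hpΔ _ hqΔ).2
    ⟨p, q, hp.2.trans hq.1, fun s => π (σ s), fun s hs u hu => hgeod s (hpq hs) u (hpq hu)⟩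
    rfl rfl (fun _ _ => mem_univ _) t ⟨hp.2, hq.1⟩) htΔ

end IsSimpleBranchedCover

/-- A `1`-Lipschitz map on an interval whose endpoints realize the length of the interval is
isometric. -/
lemma dist_eq_abs_sub_of_dist_endpoints {X : Type*} [MetricSpace X] {f : ℝ → X} {a b : ℝ}
    (hlip : ∀ s ∈ Icc a b, ∀ t ∈ Icc a b, dist (f s) (f t) ≤ |s - t|)
    (hend : b - a ≤ dist (f a) (f b)) :
    ∀ s ∈ Icc a b, ∀ t ∈ Icc a b, dist (f s) (f t) = |s - t| := by
  intro s hs t ht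
  wlog hst : s ≤ t generalizing s t
  · rw [dist_comm, abs_sub_comm, this t ht s hs (le_of_not_ge hst)]
  refine le_antisymm (hlip s hs t ht) ?_
  have hab : a ≤ b := hs.1.trans hs.2
  have h₁ := hlip a (left_mem_Icc.2 hab) s hs
  have h₂ := hlip t ht b (right_mem_Icc.2 hab)
  rw [abs_sub_comm, abs_of_nonneg (sub_nonneg.2 hs.1)] at h₁
  rw [abs_sub_comm, abs_of_nonneg (sub_nonneg.2 ht.2)] at h₂
  rw [abs_sub_comm, abs_of_nonneg (sub_nonneg.2 hst)]
  linarith [dist_triangle4 (f a) (f s) (f t) (f b)]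

/-- Lemma 3.2(ii): a path in the branched cover projecting to a geodesic of the base is the
unique geodesic with its endpoints. -/
theorem stmt_3 {X Y : Type*} [MetricSpace X] [MetricSpace Y] (κ : ℝ)
    (Δ : Set X) (hΔclosed : IsClosed Δ) (hΔconvex : IsConvexSubset Δ)
    (hX : IsCATSpace κ X) (π : Y → X) (hπ : IsSimpleBranchedCover π Δ)
    (hdiam : 0 < κ →
      EMetric.diam (Set.univ : Set X) < ENNReal.ofReal (Real.pi / (2 * Real.sqrt κ)) ∧
      EMetric.diam (Set.univ : Set Y) < ENNReal.ofReal (2 * Real.pi / (3 * Real.sqrt κ)))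
    (δ : MPath Y) (γ : GeodesicIn X) (ha : δ.a = γ.a) (hb : δ.b = γ.b)
    (hproj : ∀ t ∈ Set.Icc δ.a δ.b, π (δ.toFun t) = γ.toFun t) :
    (∀ s ∈ Set.Icc δ.a δ.b, ∀ t ∈ Set.Icc δ.a δ.b,
      dist (δ.toFun s) (δ.toFun t) = |s - t|) ∧
    ∀ γ' : GeodesicIn Y, γ'.initial = δ.initial → γ'.final = δ.final →
      γ'.b - γ'.a = δ.b - δ.a ∧
      ∀ t ∈ Set.Icc γ'.a γ'.b, γ'.toFun t = δ.toFun (t - γ'.a + δ.a) := by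
  have hδgeod : ∀ s ∈ Icc δ.a δ.b, ∀ t ∈ Icc δ.a δ.b,
      dist (π (δ.toFun s)) (π (δ.toFun t)) = |s - t| := by
    intro s hs t ht
    rw [hproj s hs, hproj t ht]
    rw [ha, hb] at hs ht
    exact γ.isom s hs t ht
  have hδ := hπ.dist_lift_eq δ.cont hδgeod
  refine ⟨hδ, fun γ' h0 h1 => ?_⟩
  simp only [GeodesicIn.initial, GeodesicIn.final, MPath.initial, MPath.final] at h0 h1
  have hlen : γ'.b - γ'.a = δ.b - δ.a := by
    have e₁ := γ'.isom _ (left_mem_Icc.2 γ'.hab) _ (right_mem_Icc.2 γ'.hab)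
    rw [h0, h1, hδ _ (left_mem_Icc.2 δ.hab) _ (right_mem_Icc.2 δ.hab), abs_sub_comm,
      abs_of_nonneg (sub_nonneg.2 δ.hab), abs_sub_comm,
      abs_of_nonneg (sub_nonneg.2 γ'.hab)] at e₁
    exact e₁.symm
  refine ⟨hlen, ?_⟩
  set L := δ.b - δ.a with hL
  have hL0 : 0 ≤ L := sub_nonneg.2 δ.hab
  have memδ : ∀ t ∈ Icc 0 L, t + δ.a ∈ Icc δ.a δ.b := fun t ht =>
    ⟨by linarith [ht.1], by linarith [ht.2]⟩
  have memγ' : ∀ t ∈ Icc 0 L, t + γ'.a ∈ Icc γ'.a γ'.b := fun t ht =>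
    ⟨by linarith [ht.1], by linarith [ht.2]⟩
  let σ : ℝ → Y := fun t => δ.toFun (t + δ.a)
  let τ : ℝ → Y := fun t => γ'.toFun (t + γ'.a)
  have hτ : ∀ s ∈ Icc 0 L, ∀ t ∈ Icc 0 L, dist (τ s) (τ t) = |s - t| := fun s hs t ht => by
    simpa using γ'.isom _ (memγ' s hs) _ (memγ' t ht)
  have hσ : ∀ s ∈ Icc 0 L, ∀ t ∈ Icc 0 L, dist (σ s) (σ t) = |s - t| := fun s hs t ht => by
    simpa using hδ _ (memδ s hs) _ (memδ t ht)
  have hπσ : ∀ s ∈ Icc 0 L, ∀ t ∈ Icc 0 L, dist (π (σ s)) (π (σ t)) = |s - t| :=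
    fun s hs t ht => by simpa using hδgeod _ (memδ s hs) _ (memδ t ht)
  have cont_of_isom : ∀ f : ℝ → Y, (∀ s ∈ Icc 0 L, ∀ t ∈ Icc 0 L, dist (f s) (f t) = |s - t|) →
      ContinuousOn f (Icc 0 L) := fun f hf => Metric.continuousOn_iff.2 fun x hx ε hε =>
    ⟨ε, hε, fun y hy hyx => by rwa [hf y hy x hx]⟩
  have hστ0 : σ 0 = τ 0 := by simp [σ, τ, h0]
  have hστL : σ L = τ L := by
    have e : L + γ'.a = γ'.b := by linarith
    simp [σ, τ, e, h1, L]
  have hendpt : dist (π (σ 0)) (π (σ L)) = L := by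
    rw [hπσ 0 ⟨le_rfl, hL0⟩ L ⟨hL0, le_rfl⟩, zero_sub, abs_neg, abs_of_nonneg hL0]
  have hπτ : ∀ s ∈ Icc 0 L, ∀ t ∈ Icc 0 L, dist (π (τ s)) (π (τ t)) = |s - t| :=
    dist_eq_abs_sub_of_dist_endpoints (f := fun t => π (τ t))
      (fun s hs t ht => hτ s hs t ht ▸ hπ.dist_map_le _ _)
      (by rw [← hστ0, ← hστL, hendpt, sub_zero])
  have hLκ : 0 < κ → L < Real.pi / Real.sqrt κ := by
    intro hκ
    have hk : 0 < Real.sqrt κ := Real.sqrt_pos.2 hκ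
    have hlt := (Metric.edist_le_ediam_of_mem (mem_univ (π (σ 0))) (mem_univ (π (σ L)))).trans_lt
      (hdiam hκ).1
    rw [edist_dist, hendpt, ENNReal.ofReal_lt_ofReal_iff (by positivity)] at hlt
    refine hlt.trans_le (div_le_div_of_nonneg_left Real.pi_pos.le hk (by linarith))
  have hproj' : ∀ t ∈ Icc 0 L, π (σ t) = π (τ t) :=
    hX.eqOn_of_endpoints_eq hπσ hπτ (congrArg π hστ0) (congrArg π hστL) hLκ
  have heq := hπ.eqOn_lifts_of_endpoints_eq hΔconvex (cont_of_isom σ hσ) (cont_of_isom τ hτ)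
    hproj' hπσ hστ0 hστL
  intro t ht
  simpa [σ, τ] using (heq (x := t - γ'.a) ⟨by linarith [ht.1], by linarith [ht.2]⟩).symm
end

section
/- Let Δ be a closed convex subset of a CAT(κ) space X̂ and let π : Ŷ → X̂ be a simple branched cover of X̂ over Δ; if κ > 0, assume additionally Diam(X̂) < π/(2√κ) and Diam(Ŷ) < 2π/(3√κ). Then every geodesic of Ŷ whose image misses Δ projects under π to a geodesic of X̂. (Lemma 3.2(iv)) -/
open Set Metric
open scoped ENNReal

theorem le_neg_one_of_cos_arccos_le {x : ℝ} (h : Real.cos (Real.arccos x) ≤ -1) : x ≤ -1 := by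
  rw [← Real.arccos_eq_pi]
  refine Real.injOn_cos ⟨Real.arccos_nonneg x, Real.arccos_le_pi x⟩
    ⟨Real.pi_pos.le, le_rfl⟩ ?_
  rw [Real.cos_pi]
  exact le_antisymm h (Real.neg_one_le_cos _)

theorem le_of_le_arcoshReal {x y : ℝ} (hx : 0 < x) (h : x ≤ arcoshReal y) (hy : 1 ≤ y) :
    Real.cosh x ≤ y := by
  have hsq : 0 ≤ y ^ 2 - 1 := by nlinarith
  have hr := Real.sqrt_nonneg (y ^ 2 - 1)
  have hr2 := Real.sq_sqrt hsq
  have hpos : 0 < y + Real.sqrt (y ^ 2 - 1) := by linarith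
  have h1 : Real.exp x ≤ y + Real.sqrt (y ^ 2 - 1) := by
    rw [← Real.le_log_iff_exp_le hpos]
    exact h
  by_contra! hlt
  have hc := Real.cosh_sq x
  have hs : Real.sqrt (y ^ 2 - 1) < Real.sinh x := by
    rw [Real.sqrt_lt' (Real.sinh_pos_iff.2 hx)]
    nlinarith
  have := Real.cosh_add_sinh x
  linarith

/-- In the model space, if two points at equal distance `η` from a vertex along the two adjacent
sides of a triangle are at distance at least `2 * η`, the triangle is degenerate. -/
theorem add_le_of_two_mul_le_modelDistFromVertex {κ x y z η : ℝ} (hη : 0 < η) (hηx : η ≤ x)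
    (hηy : η ≤ y) (hz : 0 ≤ z) (hκ : 0 < κ → Real.sqrt κ * (x + y) < Real.pi)
    (h : 2 * η ≤ modelDistFromVertex κ η η (modelAngle κ x y z)) : x + y ≤ z := by
  have hx : 0 < x := hη.trans_le hηx
  have hy : 0 < y := hη.trans_le hηy
  unfold modelDistFromVertex modelAngle at h
  split_ifs at h with h0 hneg
  · rw [Real.le_sqrt' (by positivity)] at h
    have h1 := le_neg_one_of_cos_arccos_le (by
      have : 0 < η ^ 2 := by positivity
      nlinarith)
    rw [div_le_iff₀ (by positivity)] at h1
    exact le_of_sq_le_sq (by nlinarith) hz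
  · have hk : 0 < Real.sqrt (-κ) := Real.sqrt_pos.2 (by linarith)
    set k := Real.sqrt (-κ)
    rw [one_div, inv_mul_eq_div, le_div_iff₀ hk] at h
    have hs : 0 < Real.sinh (k * η) := Real.sinh_pos_iff.2 (by positivity)
    have hc := Real.cosh_sq (k * η)
    set θ := Real.arccos _
    have h2 := le_of_le_arcoshReal (by positivity) h (by
      nlinarith [Real.cos_le_one θ, mul_pos hs hs])
    have h1 : Real.cos θ ≤ -1 := by
      rw [show 2 * η * k = 2 * (k * η) by ring, Real.cosh_two_mul] at h2
      nlinarith [mul_pos hs hs]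
    have h3 := le_neg_one_of_cos_arccos_le h1
    have hsx : 0 < Real.sinh (k * x) := Real.sinh_pos_iff.2 (by positivity)
    have hsy : 0 < Real.sinh (k * y) := Real.sinh_pos_iff.2 (by positivity)
    rw [div_le_iff₀ (by positivity)] at h3
    have h4 : Real.cosh (k * x + k * y) ≤ Real.cosh (k * z) := by
      rw [Real.cosh_add]
      linarith
    rw [Real.cosh_le_cosh, abs_of_nonneg (by positivity), abs_of_nonneg (by positivity),
      ← mul_add] at h4
    exact le_of_mul_le_mul_left h4 hk
  · have hκ0 : 0 < κ := lt_of_le_of_ne (not_lt.1 hneg) (Ne.symm h0)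
    have hk : 0 < Real.sqrt κ := Real.sqrt_pos.2 hκ0
    replace hκ := hκ hκ0
    set k := Real.sqrt κ
    rw [one_div, inv_mul_eq_div, le_div_iff₀ hk] at h
    have hkx : 0 < k * x := by positivity
    have hky : 0 < k * y := by positivity
    have hηx' : k * η ≤ k * x := by gcongr
    have hηy' : k * η ≤ k * y := by gcongr
    have hkη : 0 < k * η := by positivity
    have hs : 0 < Real.sin (k * η) := Real.sin_pos_of_pos_of_lt_pi hkη (by linarith)
    have hc := Real.sin_sq_add_cos_sq (k * η)
    set θ := Real.arccos ((Real.cos (k * z) - _) / _)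
    have h2 := Real.cos_le_cos_of_nonneg_of_le_pi (by positivity) (Real.arccos_le_pi _) h
    rw [Real.cos_arccos (by nlinarith [Real.neg_one_le_cos θ, mul_pos hs hs])
      (by nlinarith [Real.cos_le_one θ, mul_pos hs hs]),
      show 2 * η * k = 2 * (k * η) by ring, Real.cos_two_mul] at h2
    have h1 : Real.cos θ ≤ -1 := by nlinarith [mul_pos hs hs]
    have h3 := le_neg_one_of_cos_arccos_le h1
    have hsx : 0 < Real.sin (k * x) := Real.sin_pos_of_pos_of_lt_pi hkx (by linarith)
    have hsy : 0 < Real.sin (k * y) := Real.sin_pos_of_pos_of_lt_pi hky (by linarith)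
    rw [div_le_iff₀ (by positivity)] at h3
    by_contra! hlt
    have h5 : k * z < k * (x + y) := by gcongr
    have h4 := Real.cos_lt_cos_of_nonneg_of_le_pi (by positivity) hκ.le h5
    rw [mul_add, Real.cos_add] at h4
    linarith

/-- The map `c` preserves distances on `S`. -/
def IsometricOn {X : Type*} [MetricSpace X] (c : ℝ → X) (S : Set ℝ) : Prop :=
  ∀ u ∈ S, ∀ v ∈ S, dist (c u) (c v) = |u - v|

/-- In a CAT(κ) space, a geodesic on `[a, t]` followed by a geodesic on `[t, b]` is
distance-preserving on endpoints, provided it is locally geodesic at `t`. -/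
theorem IsCATSpace.dist_endpoints_eq {X : Type*} [MetricSpace X] {κ : ℝ} (hX : IsCATSpace κ X)
    {c : ℝ → X} {a t b δ : ℝ} (hat : a < t) (htb : t < b) (hδ : 0 < δ)
    (h₁ : IsometricOn c (Icc a t)) (h₂ : IsometricOn c (Icc t b))
    (h₃ : ∀ η, 0 < η → η < δ → η ≤ t - a → η ≤ b - t →
      dist (c (t - η)) (c (t + η)) = 2 * η)
    (hlen : 0 < κ → Real.sqrt κ * (b - a) < Real.pi) :
    dist (c a) (c b) = b - a := by
  have e₁ : dist (c a) (c t) = t - a := by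
    rw [h₁ a ⟨le_rfl, hat.le⟩ t ⟨hat.le, le_rfl⟩, abs_sub_comm, abs_of_pos (by linarith)]
  have e₂ : dist (c t) (c b) = b - t := by
    rw [h₂ t ⟨le_rfl, htb.le⟩ b ⟨htb.le, le_rfl⟩, abs_sub_comm, abs_of_pos (by linarith)]
  have hle : dist (c a) (c b) ≤ b - a := by
    linarith [dist_triangle (c a) (c t) (c b)]
  refine le_antisymm hle ?_
  obtain ⟨g, hg₁, hg₂⟩ := hX.1 (c b) (c a)
  have hg : g.length = dist (c a) (c b) := by
    have := g.isom g.a ⟨le_rfl, g.hab⟩ g.b ⟨g.hab, le_rfl⟩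
    rw [abs_sub_comm, abs_of_nonneg (sub_nonneg.2 g.hab)] at this
    rw [GeodesicIn.length, ← this, ← hg₁, ← hg₂, dist_comm]
    rfl
  let T : TriangleIn X :=
    { edge := ![⟨a, t, hat.le, c, h₁⟩, ⟨t, b, htb.le, c, h₂⟩, g]
      compat := by
        intro i
        fin_cases i
        · rfl
        · exact hg₁.symm
        · exact hg₂ }
  have hper : T.perimeter = (t - a) + (b - t) + dist (c a) (c b) := by
    rw [← hg, TriangleIn.perimeter, Fin.sum_univ_three]
    rfl
  obtain ⟨η, hη, hηδ, hη₁, hη₂⟩ : ∃ η, 0 < η ∧ η < δ ∧ η ≤ t - a ∧ η ≤ b - t := by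
    refine ⟨min (δ / 2) (min (t - a) (b - t)), ?_, ?_, ?_, ?_⟩
    · exact lt_min (by linarith) (lt_min (by linarith) (by linarith))
    · exact (min_le_left _ _).trans_lt (by linarith)
    · exact (min_le_right _ _).trans (min_le_left _ _)
    · exact (min_le_right _ _).trans (min_le_right _ _)
  have key := (hX.2 T (fun hκ => by
    have hk := Real.sqrt_pos.2 hκ
    rw [lt_div_iff₀ hk, hper]
    nlinarith [hlen hκ])).2 0 1 (t - η) ⟨by change a ≤ _; linarith, by change _ ≤ t; linarith⟩
      (t + η) ⟨by change t ≤ _; linarith, by change _ ≤ b; linarith⟩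
  change dist (c (t - η)) (c (t + η)) ≤
    modelDistFromVertex κ (t - (t - η)) (t + η - t) (modelAngle κ (t - a) (b - t) g.length) at key
  rw [h₃ η hη hηδ hη₁ hη₂, sub_sub_cancel, add_sub_cancel_left, hg] at key
  have := add_le_of_two_mul_le_modelDistFromVertex hη hη₁ hη₂ dist_nonneg
    (fun hκ => by rw [sub_add_sub_cancel']; exact hlen hκ) key
  linarith

theorem IsCATSpace.isometricOn_extend {X : Type*} [MetricSpace X] {κ : ℝ} (hX : IsCATSpace κ X)
    {c : ℝ → X} {a t b δ : ℝ} (hat : a ≤ t) (hbt : b < t + δ)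
    (h₁ : IsometricOn c (Icc a t)) (h₂ : IsometricOn c (ball t δ ∩ Icc a b))
    (hlen : 0 < κ → Real.sqrt κ * (b - a) < Real.pi) :
    IsometricOn c (Icc a b) := by
  have hR : ∀ u ∈ Icc t b, u ∈ ball t δ ∩ Icc a b := fun u hu => by
    refine ⟨?_, hat.trans hu.1, hu.2⟩
    rw [mem_ball, Real.dist_eq, abs_of_nonneg (sub_nonneg.2 hu.1)]
    linarith [hu.2]
  have h₂' : IsometricOn c (Icc t b) := fun u hu v hv => h₂ u (hR u hu) v (hR v hv)
  have hstart : ∀ v ∈ Icc a b, dist (c a) (c v) = v - a := by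
    intro v hv
    rcases le_or_gt v t with hvt | hvt
    · rw [h₁ a ⟨le_rfl, hat⟩ v ⟨hv.1, hvt⟩, abs_sub_comm, abs_of_nonneg (sub_nonneg.2 hv.1)]
    rcases hat.eq_or_lt with rfl | hat'
    · rw [h₂' a ⟨le_rfl, hv.1.trans hv.2⟩ v hv, abs_sub_comm, abs_of_nonneg (sub_nonneg.2 hv.1)]
    · refine hX.dist_endpoints_eq hat' hvt (δ := δ) (by linarith [hv.2]) h₁
        (fun x hx y hy => h₂' x ⟨hx.1, hx.2.trans hv.2⟩ y ⟨hy.1, hy.2.trans hv.2⟩) ?_ ?_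
      · intro η hη hηδ hη₁ hη₂
        have hv2 := hv.2
        rw [h₂ (t - η) ⟨?_, by constructor <;> linarith⟩ (t + η) ⟨?_, by constructor <;> linarith⟩,
          show t - η - (t + η) = -(2 * η) by ring, abs_neg, abs_of_pos (by linarith)]
        · rw [mem_ball, Real.dist_eq, sub_sub_cancel_left, abs_neg, abs_of_pos hη]
          exact hηδ
        · rw [mem_ball, Real.dist_eq, add_sub_cancel_left, abs_of_pos hη]
          exact hηδ
      · intro hκ
        refine lt_of_le_of_lt ?_ (hlen hκ)
        gcongr
        exact hv.2
  have hle : ∀ u ∈ Icc a b, ∀ v ∈ Icc a b, u ≤ v → dist (c u) (c v) = v - u := by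
    intro u hu v hv huv
    refine le_antisymm ?_ ?_
    · rcases le_total v t with hvt | hvt
      · rw [h₁ u ⟨hu.1, huv.trans hvt⟩ v ⟨hv.1, hvt⟩, abs_sub_comm,
          abs_of_nonneg (sub_nonneg.2 huv)]
      rcases le_total u t with hut | hut
      · have e₁ := h₁ u ⟨hu.1, hut⟩ t ⟨hat, le_rfl⟩
        have e₂ := h₂' t ⟨le_rfl, hvt.trans hv.2⟩ v ⟨hvt, hv.2⟩
        rw [abs_sub_comm, abs_of_nonneg (sub_nonneg.2 hut)] at e₁
        rw [abs_sub_comm, abs_of_nonneg (sub_nonneg.2 hvt)] at e₂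
        linarith [dist_triangle (c u) (c t) (c v)]
      · rw [h₂' u ⟨hut, hu.2⟩ v ⟨hvt, hv.2⟩, abs_sub_comm, abs_of_nonneg (sub_nonneg.2 huv)]
    · linarith [dist_triangle (c a) (c u) (c v), hstart u hu, hstart v hv]
  intro u hu v hv
  rcases le_total u v with huv | huv
  · rw [hle u hu v hv huv, abs_sub_comm, abs_of_nonneg (sub_nonneg.2 huv)]
  · rw [dist_comm, hle v hv u hu huv, abs_of_nonneg (sub_nonneg.2 huv)]

/-- Local geodesics of length `< π / √κ` in a CAT(κ) space are geodesics. -/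
theorem IsCATSpace.isometricOn_of_locally {X : Type*} [MetricSpace X] {κ : ℝ}
    (hX : IsCATSpace κ X) {c : ℝ → X} {a b : ℝ}
    (hloc : ∀ t ∈ Icc a b, ∃ ε > 0, IsometricOn c (ball t ε ∩ Icc a b))
    (hlen : 0 < κ → Real.sqrt κ * (b - a) < Real.pi) :
    IsometricOn c (Icc a b) := by
  choose! ε hε hiso using hloc
  obtain ⟨δ, hδ, hcov⟩ := lebesgue_number_lemma_of_metric (isCompact_Icc (a := a) (b := b))
    (c := fun i : Icc a b => ball (i : ℝ) (ε i)) (fun _ => isOpen_ball)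
    (fun x hx => mem_iUnion.2 ⟨⟨x, hx⟩, mem_ball_self (hε x hx)⟩)
  have hδiso : ∀ t ∈ Icc a b, IsometricOn c (ball t δ ∩ Icc a b) := fun t ht => by
    obtain ⟨i, hi⟩ := hcov t ht
    exact fun u hu v hv => hiso i i.2 u ⟨hi hu.1, hu.2⟩ v ⟨hi hv.1, hv.2⟩
  have hind : ∀ n : ℕ, ∀ t ∈ Icc a b, t ≤ a + n * (δ / 2) → IsometricOn c (Icc a t) := by
    intro n
    induction n with
    | zero =>
      intro t ht hta u hu v hv
      simp only [Nat.cast_zero, zero_mul, add_zero] at hta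
      obtain rfl : u = v := by linarith [hu.1, hu.2, hv.1, hv.2]
      simp
    | succ n ih =>
      intro t ht hta
      push_cast at hta
      have hs : max a (t - δ / 2) ∈ Icc a b :=
        ⟨le_max_left _ _, max_le (ht.1.trans ht.2) (by linarith [ht.2])⟩
      refine hX.isometricOn_extend (t := max a (t - δ / 2)) (δ := δ) hs.1
        (by linarith [le_max_right a (t - δ / 2)]) (ih _ hs ?_)
        (fun u hu v hv => hδiso _ hs u ⟨hu.1, hu.2.1, hu.2.2.trans ht.2⟩ v
          ⟨hv.1, hv.2.1, hv.2.2.trans ht.2⟩) ?_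
      · refine max_le ?_ (by linarith)
        have : 0 ≤ (n : ℝ) * (δ / 2) := by positivity
        linarith
      · intro hκ
        refine lt_of_le_of_lt ?_ (hlen hκ)
        gcongr
        exact ht.2
  rcases le_or_gt a b with hab | hab
  · obtain ⟨n, hn⟩ := exists_nat_ge ((b - a) / (δ / 2))
    rw [div_le_iff₀ (by positivity)] at hn
    exact hind n b ⟨hab, le_rfl⟩ (by linarith)
  · intro u hu
    linarith [hu.1, hu.2]

/-- Lemma 3.2(iv): a geodesic of the branched cover missing Δ projects to a geodesic of the
base. -/
theorem stmt_5 {X Y : Type*} [MetricSpace X] [MetricSpace Y] (κ : ℝ)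
    (Δ : Set X) (hΔclosed : IsClosed Δ) (hΔconvex : IsConvexSubset Δ)
    (hX : IsCATSpace κ X) (π : Y → X) (hπ : IsSimpleBranchedCover π Δ)
    (hdiam : 0 < κ →
      EMetric.diam (Set.univ : Set X) < ENNReal.ofReal (Real.pi / (2 * Real.sqrt κ)) ∧
      EMetric.diam (Set.univ : Set Y) < ENNReal.ofReal (2 * Real.pi / (3 * Real.sqrt κ)))
    (γ : GeodesicIn Y) (hmiss : ∀ t ∈ Set.Icc γ.a γ.b, π (γ.toFun t) ∉ Δ) :
    ∀ s ∈ Set.Icc γ.a γ.b, ∀ t ∈ Set.Icc γ.a γ.b,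
      dist (π (γ.toFun s)) (π (γ.toFun t)) = |s - t| := by
  refine hX.isometricOn_of_locally (c := fun t => π (γ.toFun t)) (fun t ht => ?_) (fun hκ => ?_)
  · obtain ⟨ε, hε, h⟩ := hπ.locally_isometric _ (hmiss t ht)
    have hball : ∀ u ∈ ball t ε ∩ Icc γ.a γ.b, dist (γ.toFun u) (γ.toFun t) < ε :=
      fun u hu => by
        rw [γ.isom u hu.2 t ht]
        exact hu.1
    exact ⟨ε, hε, fun u hu v hv => by
      rw [h _ _ (hmiss u hu.2) (hmiss v hv.2) (hball u hu) (hball v hv), γ.isom u hu.2 v hv.2]⟩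
  · have hk := Real.sqrt_pos.2 hκ
    have h1 := (Metric.edist_le_ediam_of_mem (mem_univ (γ.toFun γ.b))
      (mem_univ (γ.toFun γ.a))).trans_lt (hdiam hκ).2
    rw [edist_dist, ENNReal.ofReal_lt_ofReal_iff (by positivity),
      γ.isom γ.b ⟨γ.hab, le_rfl⟩ γ.a ⟨le_rfl, γ.hab⟩, abs_of_nonneg (sub_nonneg.2 γ.hab),
      lt_div_iff₀ (by positivity)] at h1
    nlinarith [Real.pi_pos]
end

section
/- Let X be a length space with metric d. Let Y be a path-connected subset of X with the property that δ(y,z) = inf { ℓ(γ) : γ a path in Y joining y and z } is finite for all y, z ∈ Y, so that (Y,δ) is a length space. Suppose also that (Y,δ) is CAT(κ) for some κ ∈ ℝ. Then any point of the interior of Y admits a neighborhood which is convex in X and also CAT(κ). (Lemma 4.1) -/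
open Set Metric
open scoped ENNReal

section ModelSpace

theorem Real.le_cos_arccos {u : ℝ} (hu : u ≤ 1) : u ≤ Real.cos (Real.arccos u) := by
  rcases le_total (-1) u with h | h
  · rw [Real.cos_arccos h hu]
  · exact h.trans (Real.neg_one_le_cos _)

theorem arcoshReal_le {y m : ℝ} (hm : 0 ≤ m) (hy : 1 ≤ y) (h : y ≤ Real.cosh m) :
    arcoshReal y ≤ m := by
  have hs : Real.sqrt (y ^ 2 - 1) ≤ Real.sinh m := by
    rw [← Real.sqrt_sq (Real.sinh_nonneg_iff.mpr hm)]
    apply Real.sqrt_le_sqrt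
    have := Real.cosh_sq m
    nlinarith
  have hpos : 0 < y + Real.sqrt (y ^ 2 - 1) := by positivity
  calc arcoshReal y ≤ Real.log (Real.exp m) := by
        apply Real.log_le_log hpos
        rw [← Real.cosh_add_sinh]
        exact add_le_add h hs
    _ = m := Real.log_exp m

theorem Real.cosh_combination_le {c t A B M : ℝ} (ht : 0 ≤ t) (htc : t ≤ c) (hM : 0 ≤ M)
    (hA : A ≤ M) (hB : B ≤ M) :
    A * Real.sinh (c - t) + B * Real.sinh t ≤ M * Real.sinh c := by
  have h1 : 0 ≤ Real.sinh (c - t) := Real.sinh_nonneg_iff.mpr (by linarith)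
  have h2 : 0 ≤ Real.sinh t := Real.sinh_nonneg_iff.mpr ht
  have h3 : Real.sinh (c - t) + Real.sinh t ≤ Real.sinh c := by
    have h := Real.sinh_add (c - t) t
    rw [sub_add_cancel] at h
    nlinarith [Real.one_le_cosh t, Real.one_le_cosh (c - t)]
  nlinarith

theorem Real.le_cos_combination {c t A B M : ℝ} (ht : 0 ≤ t) (htc : t ≤ c) (hc : c ≤ Real.pi)
    (hM : 0 ≤ M) (hA : M ≤ A) (hB : M ≤ B) :
    M * Real.sin c ≤ A * Real.sin (c - t) + B * Real.sin t := by
  have h1 : 0 ≤ Real.sin (c - t) := Real.sin_nonneg_of_nonneg_of_le_pi (by linarith) (by linarith)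
  have h2 : 0 ≤ Real.sin t := Real.sin_nonneg_of_nonneg_of_le_pi ht (by linarith)
  have h3 : Real.sin c ≤ Real.sin (c - t) + Real.sin t := by
    have h := Real.sin_add (c - t) t
    rw [sub_add_cancel] at h
    nlinarith [Real.cos_le_one t, Real.cos_le_one (c - t)]
  nlinarith

/-- In the model space, the distance from a vertex to a point of the opposite side is at most
the larger of the two sides at that vertex, provided those are shorter than a quarter of a
great circle. -/
theorem modelDistFromVertex_modelAngle_le {κ s c e t m : ℝ} (hs : 0 < s) (hc : 0 < c)
    (hsc : s ≤ c + e) (hcs : c ≤ s + e) (ht : 0 ≤ t) (htc : t ≤ c)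
    (hsm : s ≤ m) (hem : e ≤ m) (hκ : 0 < κ → m < Real.pi / (2 * Real.sqrt κ)) :
    modelDistFromVertex κ s t (modelAngle κ s c e) ≤ m := by
  have he : 0 ≤ e := by linarith
  have hm : 0 ≤ m := by linarith
  unfold modelDistFromVertex modelAngle
  split_ifs with h0 hneg
  · set u := (s ^ 2 + c ^ 2 - e ^ 2) / (2 * s * c) with hu
    have hpos : 0 < 2 * s * c := by positivity
    have hu1 : u ≤ 1 := by rw [hu, div_le_one hpos]; nlinarith
    have hcos := Real.le_cos_arccos hu1
    rw [Real.sqrt_le_left hm]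
    have hu2 : u * (2 * s * c) = s ^ 2 + c ^ 2 - e ^ 2 := div_mul_cancel₀ _ hpos.ne'
    have h1 : 2 * s * t * u ≤ 2 * s * t * Real.cos (Real.arccos u) := by gcongr
    suffices s ^ 2 + t ^ 2 - 2 * s * t * u ≤ m ^ 2 by linarith
    have hs2 : s ^ 2 ≤ m ^ 2 := by gcongr
    have he2 : e ^ 2 ≤ m ^ 2 := by gcongr
    have hct : 0 ≤ c - t := by linarith
    refine le_of_mul_le_mul_left ?_ hc
    calc c * (s ^ 2 + t ^ 2 - 2 * s * t * u)
        = c * s ^ 2 + c * t ^ 2 - t * (u * (2 * s * c)) := by ring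
      _ = (c - t) * s ^ 2 + t * e ^ 2 - c * t * (c - t) := by rw [hu2]; ring
      _ ≤ (c - t) * m ^ 2 + t * m ^ 2 := by
          have : 0 ≤ c * t * (c - t) := by positivity
          nlinarith
      _ = c * m ^ 2 := by ring
  · set k := Real.sqrt (-κ)
    have hk : 0 < k := Real.sqrt_pos.mpr (by linarith)
    have hss : 0 < Real.sinh (k * s) := Real.sinh_pos_iff.mpr (by positivity)
    have hsc' : 0 < Real.sinh (k * c) := Real.sinh_pos_iff.mpr (by positivity)
    have hst : 0 ≤ Real.sinh (k * t) := Real.sinh_nonneg_iff.mpr (by positivity)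
    set u := (Real.cosh (k * s) * Real.cosh (k * c) - Real.cosh (k * e)) /
      (Real.sinh (k * s) * Real.sinh (k * c)) with hu
    have hpos := mul_pos hss hsc'
    have hu1 : u ≤ 1 := by
      rw [hu, div_le_one hpos]
      have h := Real.cosh_sub (k * s) (k * c)
      have : Real.cosh (k * s - k * c) ≤ Real.cosh (k * e) := by
        rw [Real.cosh_le_cosh, ← mul_sub, abs_mul, abs_mul, abs_of_nonneg he]
        gcongr
        exact abs_le.mpr ⟨by linarith, by linarith⟩
      linarith
    have hcos := Real.le_cos_arccos hu1
    have hu2 : u * (Real.sinh (k * s) * Real.sinh (k * c)) =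
      Real.cosh (k * s) * Real.cosh (k * c) - Real.cosh (k * e) := div_mul_cancel₀ _ hpos.ne'
    rw [one_div, inv_mul_le_iff₀ hk]
    apply arcoshReal_le (by positivity)
    · have h1 := Real.one_le_cosh (k * s - k * t)
      rw [Real.cosh_sub] at h1
      have := mul_le_mul_of_nonneg_left (Real.cos_le_one (Real.arccos u)) (mul_nonneg hss.le hst)
      linarith
    · have h1 : Real.sinh (k * s) * Real.sinh (k * t) * u ≤
          Real.sinh (k * s) * Real.sinh (k * t) * Real.cos (Real.arccos u) := by gcongr
      suffices Real.cosh (k * s) * Real.cosh (k * t) - Real.sinh (k * s) * Real.sinh (k * t) * u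
          ≤ Real.cosh (k * m) by linarith
      have hcomb := Real.cosh_combination_le (c := k * c) (t := k * t) (by positivity)
        (by gcongr) (Real.cosh_pos (k * m)).le
        (Real.cosh_le_cosh.mpr (by rw [abs_of_nonneg, abs_of_nonneg] <;> first | gcongr | positivity)
          : Real.cosh (k * s) ≤ _)
        (Real.cosh_le_cosh.mpr (by rw [abs_of_nonneg, abs_of_nonneg] <;> first | gcongr | positivity)
          : Real.cosh (k * e) ≤ _)
      rw [Real.sinh_sub] at hcomb
      refine le_of_mul_le_mul_right ?_ hsc'
      linear_combination hcomb - Real.sinh (k * t) * hu2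
  · have hκ0 : 0 < κ := lt_of_le_of_ne (not_lt.mp hneg) (Ne.symm h0)
    specialize hκ hκ0
    set k := Real.sqrt κ
    have hk : 0 < k := Real.sqrt_pos.mpr hκ0
    have hkm : k * m < Real.pi / 2 := by
      rw [lt_div_iff₀ (by positivity)] at hκ
      linarith
    have hks : k * s ≤ k * m := by gcongr
    have hke : k * e ≤ k * m := by gcongr
    have hke0 : 0 ≤ k * e := by positivity
    have hkm0 : 0 ≤ k * m := by positivity
    have hks0 : 0 < k * s := by positivity
    have hkc0 : 0 < k * c := by positivity
    have hkt0 : 0 ≤ k * t := by positivity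
    have hktc : k * t ≤ k * c := by gcongr
    have hkc : k * c ≤ k * s + k * e := by rw [← mul_add]; gcongr
    have hks' : k * s ≤ k * c + k * e := by rw [← mul_add]; gcongr
    have hss : 0 < Real.sin (k * s) := Real.sin_pos_of_pos_of_lt_pi hks0 (by linarith)
    have hsc' : 0 < Real.sin (k * c) := Real.sin_pos_of_pos_of_lt_pi hkc0 (by linarith)
    have hst : 0 ≤ Real.sin (k * t) := Real.sin_nonneg_of_nonneg_of_le_pi hkt0 (by linarith)
    set u := (Real.cos (k * e) - Real.cos (k * s) * Real.cos (k * c)) /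
      (Real.sin (k * s) * Real.sin (k * c)) with hu
    have hpos := mul_pos hss hsc'
    have hu1 : u ≤ 1 := by
      rw [hu, div_le_one hpos]
      have h := Real.cos_sub (k * s) (k * c)
      have : Real.cos (k * e) ≤ Real.cos (k * s - k * c) := by
        rw [← Real.cos_abs (k * s - k * c)]
        exact Real.cos_le_cos_of_nonneg_of_le_pi (abs_nonneg _) (by linarith)
          (abs_le.mpr ⟨by linarith, by linarith⟩)
      linarith
    have hcos := Real.le_cos_arccos hu1
    have hu2 : u * (Real.sin (k * s) * Real.sin (k * c)) =
      Real.cos (k * e) - Real.cos (k * s) * Real.cos (k * c) := div_mul_cancel₀ _ hpos.ne'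
    rw [one_div, inv_mul_le_iff₀ hk, ← Real.arccos_cos hkm0 (by linarith)]
    apply Real.arccos_le_arccos
    have h1 : Real.sin (k * s) * Real.sin (k * t) * u ≤
        Real.sin (k * s) * Real.sin (k * t) * Real.cos (Real.arccos u) := by gcongr
    suffices Real.cos (k * m) ≤
        Real.cos (k * s) * Real.cos (k * t) + Real.sin (k * s) * Real.sin (k * t) * u by linarith
    have hcomb := Real.le_cos_combination (c := k * c) hkt0 hktc (by linarith)
      (Real.cos_nonneg_of_neg_pi_div_two_le_of_le (by linarith) hkm.le : 0 ≤ Real.cos (k * m))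
      (Real.cos_le_cos_of_nonneg_of_le_pi hks0.le (by linarith) hks)
      (Real.cos_le_cos_of_nonneg_of_le_pi hke0 (by linarith) hke)
    rw [Real.sin_sub] at hcomb
    refine le_of_mul_le_mul_right ?_ hsc'
    linear_combination hcomb - Real.sin (k * t) * hu2

end ModelSpace

namespace GeodesicIn

variable {X Z : Type*} [MetricSpace X] [MetricSpace Z]

theorem dist_initial_final (γ : GeodesicIn X) : dist γ.initial γ.final = γ.length := by
  rw [initial, final, γ.isom _ (left_mem_Icc.mpr γ.hab) _ (right_mem_Icc.mpr γ.hab), length,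
    abs_sub_comm, abs_of_nonneg (sub_nonneg.mpr γ.hab)]

theorem dist_initial_apply (γ : GeodesicIn X) {t : ℝ} (ht : t ∈ Icc γ.a γ.b) :
    dist γ.initial (γ.toFun t) = t - γ.a := by
  rw [initial, γ.isom _ (left_mem_Icc.mpr γ.hab) _ ht, abs_sub_comm,
    abs_of_nonneg (sub_nonneg.mpr ht.1)]

theorem dist_apply_final (γ : GeodesicIn X) {t : ℝ} (ht : t ∈ Icc γ.a γ.b) :
    dist (γ.toFun t) γ.final = γ.b - t := by
  rw [final, γ.isom _ ht _ (right_mem_Icc.mpr γ.hab), abs_sub_comm,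
    abs_of_nonneg (sub_nonneg.mpr ht.2)]

/-- A geodesic whose endpoints are in a ball stays in the ball of twice the radius. -/
theorem dist_lt_two_mul (γ : GeodesicIn X) {x : X} {r : ℝ} (h₁ : dist x γ.initial < r)
    (h₂ : dist x γ.final < r) {t : ℝ} (ht : t ∈ Icc γ.a γ.b) : dist x (γ.toFun t) < 2 * r := by
  have h3 := γ.dist_initial_apply ht
  have h4 := γ.dist_apply_final ht
  have h5 := γ.dist_initial_final
  have h6 := dist_triangle x γ.initial (γ.toFun t)
  have h7 := dist_triangle x γ.final (γ.toFun t)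
  have h8 := dist_triangle γ.initial x γ.final
  rw [dist_comm γ.initial x] at h8
  rw [dist_comm γ.final] at h7
  rw [length] at h5
  linarith

/-- The image of a geodesic under a map preserving distances between its points. -/
def map (γ : GeodesicIn X) (f : X → Z) (hf : ∀ s ∈ Icc γ.a γ.b, ∀ t ∈ Icc γ.a γ.b,
    dist (f (γ.toFun s)) (f (γ.toFun t)) = dist (γ.toFun s) (γ.toFun t)) : GeodesicIn Z where
  a := γ.a
  b := γ.b
  hab := γ.hab
  toFun := f ∘ γ.toFun
  isom s hs t ht := (hf s hs t ht).trans (γ.isom s hs t ht)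

end GeodesicIn

/-- In a CAT(κ) space, balls of radius less than `π / (2√κ)` contain every geodesic joining two
of their points. -/
theorem IsCATSpace.dist_lt_of_geodesic {κ : ℝ} {Z : Type*} [MetricSpace Z] (hZ : IsCATSpace κ Z)
    {z : Z} {r : ℝ} (hκ : 0 < κ → r < Real.pi / (2 * Real.sqrt κ)) (γ : GeodesicIn Z)
    (h₁ : dist z γ.initial < r) (h₂ : dist z γ.final < r) {t : ℝ} (ht : t ∈ Icc γ.a γ.b) :
    dist z (γ.toFun t) < r := by
  obtain ⟨α, hα₁, hα₂⟩ := hZ.1 z γ.initial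
  obtain ⟨β, hβ₁, hβ₂⟩ := hZ.1 γ.final z
  have hα := α.dist_initial_final
  have hβ := β.dist_initial_final
  have hγ := γ.dist_initial_final
  have hγt := γ.dist_initial_apply ht
  rw [hα₁, hα₂] at hα
  rw [hβ₁, hβ₂, dist_comm] at hβ
  have t1 := dist_triangle z γ.initial γ.final
  have t2 := dist_triangle z γ.final γ.initial
  have t3 := dist_triangle_left γ.initial γ.final z
  have t4 := dist_triangle z γ.initial (γ.toFun t)
  rw [dist_comm γ.final] at t2
  have htab : t - γ.a ≤ γ.length := by rw [GeodesicIn.length]; linarith [ht.2]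
  rcases (dist_nonneg : 0 ≤ dist z γ.initial).eq_or_lt with hs | hs
  · linarith
  rcases (dist_nonneg : 0 ≤ dist γ.initial γ.final).eq_or_lt with hc | hc
  · linarith
  let T : TriangleIn Z :=
    { edge := ![α, γ, β]
      compat := by
        intro i
        fin_cases i
        · exact hα₂
        · exact hβ₁.symm
        · exact hβ₂.trans hα₁.symm }
  have hper : T.perimeter = α.length + γ.length + β.length := by
    simp [TriangleIn.perimeter, Fin.sum_univ_three, T]
  have hT := (hZ.2 T (by
    intro hκ0
    have h := hκ hκ0
    have hk : 0 < Real.sqrt κ := Real.sqrt_pos.mpr hκ0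
    have : 2 * Real.pi / Real.sqrt κ = 4 * (Real.pi / (2 * Real.sqrt κ)) := by field_simp; norm_num
    rw [hper, this]
    linarith)).2 0 1 α.a (left_mem_Icc.mpr α.hab) t ht
  have hcmp : T.cmpDist κ 0 1 α.a t =
      modelDistFromVertex κ α.length (t - γ.a) (modelAngle κ α.length γ.length β.length) := rfl
  rw [hcmp] at hT
  have hle : modelDistFromVertex κ α.length (t - γ.a)
      (modelAngle κ α.length γ.length β.length) ≤ max (dist z γ.initial) (dist z γ.final) := by
    rw [← hα, ← hγ, ← hβ]
    refine modelDistFromVertex_modelAngle_le hs hc (by linarith) (by linarith)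
      (by linarith [ht.1]) (by linarith) (le_max_left _ _) (le_max_right _ _) fun h => ?_
    exact (max_lt h₁ h₂).trans (hκ h)
  calc dist z (γ.toFun t) = dist α.initial (γ.toFun t) := by rw [hα₁]
    _ ≤ _ := hT
    _ ≤ _ := hle
    _ < r := max_lt h₁ h₂

/-- If `V` is a geodesic subspace of `X` on which some map to a CAT(κ) space preserves distances,
then `V` is CAT(κ). -/
theorem IsCATSpace.of_isometry {κ : ℝ} {Z V : Type*} [MetricSpace Z] [MetricSpace V]
    (hZ : IsCATSpace κ Z) (hV : IsGeodesicSpace V) {f : V → Z} (hf : Isometry f) :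
    IsCATSpace κ V := by
  refine ⟨hV, fun T hT => ⟨hT, ?_⟩⟩
  let T' : TriangleIn Z :=
    { edge := fun i => (T.edge i).map f fun s _ t _ => hf.dist_eq _ _
      compat := fun i => congrArg f (T.compat i) }
  intro i j s hs t ht
  rw [← hf.dist_eq]
  exact (hZ.2 T' hT).2 i j s hs t ht

theorem IsConvexSubset.isGeodesicSpace {X : Type*} [MetricSpace X] {V : Set X}
    (hV : IsConvexSubset V) : IsGeodesicSpace V := by
  classical
  intro x y
  obtain ⟨⟨γ, h₁, h₂, -⟩, h⟩ := hV x x.2 y y.2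
  have hγ : ∀ t ∈ Icc γ.a γ.b, γ.toFun t ∈ V := h γ h₁ h₂ fun _ _ => mem_univ _
  have hval : ∀ t ∈ Icc γ.a γ.b, ((if h : γ.toFun t ∈ V then ⟨γ.toFun t, h⟩ else x : V) : X) =
      γ.toFun t := fun t ht => by rw [dif_pos (hγ t ht)]
  refine ⟨⟨γ.a, γ.b, γ.hab, fun t => if h : γ.toFun t ∈ V then ⟨γ.toFun t, h⟩ else x, ?_⟩, ?_, ?_⟩
  · intro s hs t ht
    rw [Subtype.dist_eq, hval s hs, hval t ht, γ.isom s hs t ht]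
  · exact Subtype.ext ((hval _ (left_mem_Icc.mpr γ.hab)).trans h₁)
  · exact Subtype.ext ((hval _ (right_mem_Icc.mpr γ.hab)).trans h₂)

/-- A small ball of `X` is convex and CAT(κ) as soon as the ball of twice its radius is isometric
to a ball of a CAT(κ) space. -/
theorem IsCATSpace.ball_of_local_isometry {κ : ℝ} {X Z : Type*} [MetricSpace X] [MetricSpace Z]
    (hZ : IsCATSpace κ Z) (i : Z → X) (z : Z) {r : ℝ}
    (hκ : 0 < κ → r < Real.pi / (2 * Real.sqrt κ))
    (hi : ∀ u v : Z, dist z u < 2 * r → dist z v < 2 * r → dist (i u) (i v) = dist u v)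
    (hsurj : ∀ p : X, dist (i z) p < 2 * r → ∃ u, i u = p ∧ dist z u = dist (i z) p) :
    IsConvexSubset (ball (i z) r) ∧ IsCATSpace κ ↥(ball (i z) r) := by
  have hex : ∀ p : X, ∃ u, dist (i z) p < 2 * r → i u = p ∧ dist z u = dist (i z) p := by
    intro p
    by_cases hp : dist (i z) p < 2 * r
    · obtain ⟨u, hu⟩ := hsurj p hp
      exact ⟨u, fun _ => hu⟩
    · exact ⟨z, fun h => absurd h hp⟩
  choose g hg using hex
  have hgd : ∀ p q, dist (i z) p < 2 * r → dist (i z) q < 2 * r → dist (g p) (g q) = dist p q := by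
    intro p q hp hq
    rw [← hi _ _ ((hg p hp).2.trans_lt hp) ((hg q hq).2.trans_lt hq), (hg p hp).1, (hg q hq).1]
  have hball : ∀ p ∈ ball (i z) r, dist (i z) p < r ∧ dist (i z) p < 2 * r := by
    intro p hp
    rw [mem_ball'] at hp
    have : 0 ≤ dist (i z) p := dist_nonneg
    exact ⟨hp, by linarith⟩
  have hconv : IsConvexSubset (ball (i z) r) := by
    intro x hx y hy
    obtain ⟨hx₁, hx₂⟩ := hball x hx
    obtain ⟨hy₁, hy₂⟩ := hball y hy
    constructor
    · obtain ⟨γ, h₁, h₂⟩ := hZ.1 (g x) (g y)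
      have hγ : ∀ t ∈ Icc γ.a γ.b, dist z (γ.toFun t) < 2 * r := fun t ht =>
        γ.dist_lt_two_mul (by rwa [h₁, (hg x hx₂).2]) (by rwa [h₂, (hg y hy₂).2]) ht
      refine ⟨γ.map i fun s hs t ht => hi _ _ (hγ s hs) (hγ t ht), ?_, ?_, fun _ _ => mem_univ _⟩
      · exact (congrArg i h₁).trans (hg x hx₂).1
      · exact (congrArg i h₂).trans (hg y hy₂).1
    · rintro γ rfl rfl - t ht
      have hγ : ∀ t ∈ Icc γ.a γ.b, dist (i z) (γ.toFun t) < 2 * r := fun t ht =>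
        γ.dist_lt_two_mul hx₁ hy₁ ht
      have h := hZ.dist_lt_of_geodesic (z := z) hκ
        (γ.map g fun s hs t ht => hgd _ _ (hγ s hs) (hγ t ht))
        ((hg _ hx₂).2.trans_lt hx₁) ((hg _ hy₂).2.trans_lt hy₁) ht
      rw [mem_ball', ← (hg _ (hγ t ht)).2]
      exact h
  refine ⟨hconv, hZ.of_isometry hconv.isGeodesicSpace (f := fun p => g p) ?_⟩
  exact Isometry.of_dist_eq fun p q => hgd _ _ (hball p p.2).2 (hball q q.2).2

section PathDist

variable {X : Type*} [MetricSpace X]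

theorem MPath.edist_add_edist_le_length (γ : MPath X) {t : ℝ} (ht : t ∈ Icc γ.a γ.b) :
    edist γ.initial (γ.toFun t) + edist (γ.toFun t) γ.final ≤ γ.length := by
  have h := eVariationOn.Icc_add_Icc γ.toFun ht.1 ht.2 (mem_univ t)
  simp only [univ_inter] at h
  rw [MPath.length, ← h]
  exact add_le_add
    (eVariationOn.edist_le _ (left_mem_Icc.mpr ht.1) (right_mem_Icc.mpr ht.1))
    (eVariationOn.edist_le _ (left_mem_Icc.mpr ht.2) (right_mem_Icc.mpr ht.2))

theorem edist_le_pathDistIn (S : Set X) (p q : X) : edist p q ≤ pathDistIn S p q := by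
  refine le_iInf fun γ => le_iInf fun h₁ => le_iInf fun h₂ => le_iInf fun _ => ?_
  rw [← h₁, ← h₂]
  exact eVariationOn.edist_le _ (left_mem_Icc.mpr γ.hab) (right_mem_Icc.mpr γ.hab)

/-- In a length space, the path distance in a set containing a ball agrees with the ambient
distance on the concentric ball of half the radius. -/
theorem IsLengthSpace.pathDistIn_eq (hX : IsLengthSpace X) {S : Set X} {x : X} {R : ℝ}
    (hS : ball x R ⊆ S) {p q : X} (hp : dist x p < R / 2) (hq : dist x q < R / 2) :
    pathDistIn S p q = edist p q := by
  refine le_antisymm (ENNReal.le_of_forall_pos_le_add fun ε hε _ => ?_)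
    (edist_le_pathDistIn S p q)
  set ε' : ℝ := min ε (R - dist x p - dist x q)
  have hε' : 0 < ε' := lt_min hε (by linarith)
  obtain ⟨γ, h₁, h₂, hlen⟩ := hX p q ε' hε'
  have hmem : ∀ t ∈ Icc γ.a γ.b, γ.toFun t ∈ S := by
    intro t ht
    have h := (γ.edist_add_edist_le_length ht).trans_lt hlen
    rw [h₁, h₂, edist_dist, edist_dist, ← ENNReal.ofReal_add dist_nonneg dist_nonneg,
      ENNReal.ofReal_lt_ofReal_iff (by positivity)] at h
    have h3 : ε' ≤ R - dist x p - dist x q := min_le_right _ _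
    have h4 := dist_triangle x p (γ.toFun t)
    have h5 := dist_triangle_right x (γ.toFun t) q
    have h6 := dist_triangle_left p q x
    apply hS
    rw [mem_ball']
    linarith
  calc pathDistIn S p q ≤ γ.length :=
        iInf_le_of_le γ (iInf_le_of_le h₁ (iInf_le_of_le h₂ (iInf_le_of_le hmem le_rfl)))
    _ ≤ ENNReal.ofReal (dist p q + ε') := hlen.le
    _ ≤ ENNReal.ofReal (dist p q + ε) := by gcongr; exact min_le_left _ _
    _ = edist p q + ε := by
        rw [ENNReal.ofReal_add dist_nonneg ε.coe_nonneg, ← edist_dist, ENNReal.ofReal_coe_nnreal]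

end PathDist

/-- Lemma 4.1: if a path-connected subset `Y` of a length space `X`, equipped with its induced
path metric `δ`, is CAT(κ), then every interior point of `Y` has a neighborhood which is
convex in `X` and CAT(κ). -/
theorem stmt_11 {X : Type*} [MetricSpace X] (κ : ℝ) (hX : IsLengthSpace X)
    (Y : Set X) (hconn : IsPathConnected Y)
    (hfin : ∀ y ∈ Y, ∀ z ∈ Y, pathDistIn Y y z ≠ ⊤)
    (mδ : MetricSpace ↥Y)
    (hmδ : ∀ y z : ↥Y, @dist _ mδ.toDist y z = (pathDistIn Y ↑y ↑z).toReal)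
    (hCAT : @IsCATSpace κ ↥Y mδ) :
    ∀ x ∈ interior Y, ∃ V ∈ nhds x, IsConvexSubset V ∧ IsCATSpace κ ↥V := by
  intro x hx
  obtain ⟨R, hR, hRY⟩ := Metric.isOpen_iff.mp isOpen_interior x hx
  replace hRY : ball x R ⊆ Y := hRY.trans interior_subset
  have hmem : ∀ p, dist x p < R / 2 → p ∈ Y := fun p hp =>
    hRY (by rw [mem_ball']; linarith)
  obtain ⟨r, hr, hrR, hκ⟩ : ∃ r : ℝ, 0 < r ∧ 2 * r ≤ R / 2 ∧
      (0 < κ → r < Real.pi / (2 * Real.sqrt κ)) := by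
    by_cases h : 0 < κ
    · have : 0 < Real.pi / (2 * Real.sqrt κ) :=
        div_pos Real.pi_pos (mul_pos two_pos (Real.sqrt_pos.mpr h))
      refine ⟨min (R / 4) (Real.pi / (2 * Real.sqrt κ) / 2), by positivity, ?_, fun _ => ?_⟩
      · linarith [min_le_left (R / 4) (Real.pi / (2 * Real.sqrt κ) / 2)]
      · linarith [min_le_right (R / 4) (Real.pi / (2 * Real.sqrt κ) / 2)]
    · exact ⟨R / 4, by positivity, by linarith, fun h' => absurd h' h⟩
  have hdist : ∀ u v : ↥Y, dist x u < R / 2 → dist x v < R / 2 →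
      @dist _ mδ.toDist u v = dist (u : X) v := fun u v hu hv => by
    rw [hmδ, hX.pathDistIn_eq hRY hu hv, edist_dist, ENNReal.toReal_ofReal dist_nonneg]
  have hle : ∀ u v : ↥Y, dist (u : X) v ≤ @dist _ mδ.toDist u v := fun u v => by
    rw [hmδ, dist_edist]
    exact ENNReal.toReal_mono (hfin u u.2 v v.2) (edist_le_pathDistIn Y u v)
  have hxx : dist x x < R / 2 := by rw [dist_self]; positivity
  refine ⟨ball x r, ball_mem_nhds x hr,
    @IsCATSpace.ball_of_local_isometry κ X ↥Y _ mδ hCAT Subtype.val ⟨x, hmem x hxx⟩ r hκ ?_ ?_⟩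
  · intro u v hu hv
    exact (hdist u v (((hle _ _).trans_lt hu).trans_le hrR)
      (((hle _ _).trans_lt hv).trans_le hrR)).symm
  · intro p hp
    have hp' : dist x p < R / 2 := hp.trans_le hrR
    exact ⟨⟨p, hmem p hp'⟩, rfl, hdist _ _ hxx hp'⟩
end

section
/- Let X be a length space with metric d and let X̂ be its metric completion. Then for any x, y ∈ X̂ and any ε > 0, there is a path joining x and y whose interior lies in X and whose length is less than d(x,y) + ε. (Lemma 4.2, first claim) -/
open Set Metric
open scoped ENNReal

namespace IsLengthSpace

variable {X : Type*} [MetricSpace X]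

/-- In a length space, almost shortest paths can be parametrized by the unit interval. -/
theorem exists_unitInterval_path (hX : IsLengthSpace X) (x y : X) {ε : ℝ} (hε : 0 < ε) :
    ∃ f : ℝ → X, ContinuousOn f (Icc 0 1) ∧ f 0 = x ∧ f 1 = y ∧
      eVariationOn f (Icc 0 1) ≤ ENNReal.ofReal (dist x y + ε) := by
  obtain ⟨γ, hx, hy, hl⟩ := hX x y ε hε
  have hab := γ.hab
  have hmaps : MapsTo (fun t : ℝ => γ.a + t * (γ.b - γ.a)) (Icc 0 1) (Icc γ.a γ.b) := by
    rintro t ⟨h0, h1⟩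
    constructor <;> nlinarith
  refine ⟨γ.toFun ∘ fun t => γ.a + t * (γ.b - γ.a), γ.cont.comp (by fun_prop) hmaps, ?_, ?_, ?_⟩
  · simpa [MPath.initial] using hx
  · simpa [MPath.final] using hy
  · refine le_trans ?_ hl.le
    refine eVariationOn.comp_le_of_monotoneOn _ _ (fun s _ t _ hst => ?_) hmaps
    have := mul_le_mul_of_nonneg_right hst (sub_nonneg.2 hab)
    simpa using this

end IsLengthSpace

/-- Infinite concatenation of maps, the `n`-th of which is used on `[n, n + 1]`. -/
noncomputable def concatRay {E : Type*} (f : ℕ → ℝ → E) (t : ℝ) : E := f ⌊t⌋₊ (t - ⌊t⌋₊)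

namespace concatRay

theorem eqOn {E : Type*} {f : ℕ → ℝ → E} (hf : ∀ n, f n 1 = f (n + 1) 0) (n : ℕ) :
    EqOn (concatRay f) (fun t => f n (t - n)) (Icc n (n + 1)) := by
  rintro t ⟨h0, h1⟩
  rcases h1.eq_or_lt with rfl | h1
  · have : ⌊(n : ℝ) + 1⌋₊ = n + 1 := by exact_mod_cast Nat.floor_natCast (R := ℝ) (n + 1)
    simp [concatRay, this, hf]
  · have : ⌊t⌋₊ = n := (Nat.floor_eq_iff (n.cast_nonneg.trans h0)).2 ⟨h0, h1⟩
    simp [concatRay, this]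

theorem mapsTo_sub_natCast (n : ℕ) :
    MapsTo (fun t : ℝ => t - n) (Icc n (n + 1)) (Icc 0 1) := by
  rintro t ⟨h0, h1⟩
  constructor <;> linarith

theorem continuousOn {E : Type*} [TopologicalSpace E] {f : ℕ → ℝ → E}
    (hf : ∀ n, f n 1 = f (n + 1) 0) (hc : ∀ n, ContinuousOn (f n) (Icc 0 1)) :
    ContinuousOn (concatRay f) (Ici 0) := by
  have piece (n : ℕ) : ContinuousOn (concatRay f) (Icc n (n + 1)) :=
    ((hc n).comp (by fun_prop) (mapsTo_sub_natCast n)).congr (eqOn hf n)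
  have initialSegment (n : ℕ) : ContinuousOn (concatRay f) (Icc 0 n) := by
    induction n with
    | zero => simp
    | succ n ih =>
      have := ih.union_of_isClosed (piece n) isClosed_Icc isClosed_Icc
      rw [Icc_union_Icc_eq_Icc n.cast_nonneg (by linarith)] at this
      exact_mod_cast this
  intro t ht
  obtain ⟨n, hn⟩ := exists_nat_gt t
  refine (initialSegment n t ⟨ht, hn.le⟩).mono_of_mem_nhdsWithin ?_
  rw [← Ici_inter_Iic]
  exact inter_mem_nhdsWithin _ (Iic_mem_nhds hn)

theorem eVariationOn_le {E : Type*} [PseudoEMetricSpace E] {f : ℕ → ℝ → E}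
    (hf : ∀ n, f n 1 = f (n + 1) 0) (n : ℕ) :
    eVariationOn (concatRay f) (Icc 0 n) ≤
      ∑ i ∈ Finset.range n, eVariationOn (f i) (Icc 0 1) := by
  have := eVariationOn.sum' (concatRay f) (I := fun i : ℕ => (i : ℝ)) Nat.mono_cast (n := n)
  simp only [Nat.cast_zero] at this
  rw [← this]
  refine Finset.sum_le_sum fun i _ => ?_
  push_cast
  rw [eVariationOn.eq_of_eqOn (eqOn hf i)]
  exact eVariationOn.comp_le_of_monotoneOn (f i) (fun t : ℝ => t - i)
    (fun s _ t _ h => sub_le_sub_right h _) (mapsTo_sub_natCast i)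

end concatRay

open Filter Topology in
/-- A continuous ray of finite length which converges to `x` at infinity can be reparametrized
as a path on `[0, 1]` starting at `x`. -/
theorem exists_path_of_ray {E : Type*} [PseudoEMetricSpace E] {F : ℝ → E} {x : E} {L : ℝ≥0∞}
    (hF : ContinuousOn F (Ici 0)) (hx : Tendsto F atTop (𝓝 x))
    (hL : ∀ n : ℕ, eVariationOn F (Icc 0 n) ≤ L) :
    ∃ g : ℝ → E, ContinuousOn g (Icc 0 1) ∧ g 0 = x ∧ g 1 = F 0 ∧
      (∀ t ∈ Ioc (0 : ℝ) 1, g t ∈ range F) ∧ eVariationOn g (Icc 0 1) ≤ L := by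
  let g : ℝ → E := fun t => if t ≤ 0 then x else F (t⁻¹ - 1)
  have hg : EqOn g (fun t => F (t⁻¹ - 1)) (Ioi 0) := fun t ht => if_neg (not_le.2 ht)
  have hmaps : MapsTo (fun t : ℝ => t⁻¹ - 1) (Ioc 0 1) (Ici 0) := fun t ht =>
    sub_nonneg.2 ((one_le_inv₀ ht.1).2 ht.2)
  have hanti : AntitoneOn (fun t : ℝ => t⁻¹ - 1) (Ioc 0 1) := fun s hs t _ hst =>
    sub_le_sub_right (inv_anti₀ hs.1 hst) _
  have hcIoc : ContinuousOn g (Ioc 0 1) := by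
    refine (hF.comp ?_ hmaps).congr (hg.mono Ioc_subset_Ioi_self)
    exact (continuousOn_inv₀.mono fun t ht => ht.1.ne').sub continuousOn_const
  have hlim : Tendsto g (𝓝[>] 0) (𝓝 x) := by
    refine Tendsto.congr' (hg.symm.eventuallyEq_of_mem self_mem_nhdsWithin) ?_
    exact hx.comp (tendsto_atTop_add_const_right _ _ tendsto_inv_nhdsGT_zero)
  have hg0 : g 0 = x := if_pos le_rfl
  have hc0 : ContinuousWithinAt g (Ici 0) 0 := by
    rw [← continuousWithinAt_Ioi_iff_Ici, ContinuousWithinAt, hg0]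
    exact hlim
  refine ⟨g, ?_, hg0, ?_, fun t ht => ⟨_, (hg ht.1).symm⟩, ?_⟩
  · intro t ht
    rcases ht.1.eq_or_lt with rfl | h0
    · exact hc0.mono Icc_subset_Ici_self
    · refine (hcIoc t ⟨h0, ht.2⟩).mono_of_mem_nhdsWithin ?_
      filter_upwards [self_mem_nhdsWithin, mem_nhdsWithin_of_mem_nhds (Ioi_mem_nhds h0)]
        with s hs hs0 using ⟨hs0, hs.2⟩
  · simp [hg (mem_Ioi.2 zero_lt_one)]
  · rw [← eVariationOn.eVariationOn_Ioc_eq_Icc_of_continuousWithinAt hc0,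
      eVariationOn.eq_of_eqOn (hg.mono Ioc_subset_Ioi_self)]
    refine (eVariationOn.comp_le_of_antitoneOn F _ hanti hmaps).trans ?_
    rw [eVariationOn.eq_biSup_inter_Icc]
    refine iSup₂_le fun p hp => ?_
    obtain ⟨n, hn⟩ := exists_nat_ge p.2
    refine le_trans (eVariationOn.mono F ?_) (hL n)
    exact fun t ht => ⟨ht.1, ht.2.2.trans hn⟩

open Filter Topology UniformSpace in
/-- In the completion of a length space, a point of the space and a point of the completion are
joined by almost shortest paths which leave the space at most at one endpoint. -/
theorem IsLengthSpace.exists_path_from_completion {X : Type*} [MetricSpace X]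
    (hX : IsLengthSpace X) (x : Completion X) (p : X) {ε : ℝ} (hε : 0 < ε) :
    ∃ g : ℝ → Completion X, ContinuousOn g (Icc 0 1) ∧ g 0 = x ∧ g 1 = p ∧
      (∀ t ∈ Ioc (0 : ℝ) 1, g t ∈ range ((↑) : X → Completion X)) ∧
      eVariationOn g (Icc 0 1) ≤ ENNReal.ofReal (dist x p + ε) := by
  let δ : ℕ → ℝ := fun n => ε / 6 * (1 / 2) ^ n
  have hδ (n : ℕ) : 0 < δ n := by positivity
  have hδ_succ (n : ℕ) : δ (n + 1) = δ n / 2 := by simp only [δ, pow_succ]; ring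
  have hδ_sum (n : ℕ) : ∑ i ∈ Finset.range n, δ i ≤ ε / 3 := by
    have : ∑ i ∈ Finset.range n, δ i = ε / 3 - 2 * δ n := by
      induction n with
      | zero => simp [δ]; ring
      | succ n ih => rw [Finset.sum_range_succ, ih, hδ_succ]; ring
    linarith [hδ n]
  let a : ℕ → ℝ := fun n => (if n = 0 then dist x p else 0) + δ n
  have happrox (n : ℕ) : ∃ z : X, dist x z ≤ a n ∧ (n = 0 → z = p) := by
    rcases eq_or_ne n 0 with rfl | hn
    · exact ⟨p, by simpa [a] using (hδ 0).le, fun _ => rfl⟩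
    · obtain ⟨z, hz⟩ :=
        Metric.mem_closure_range_iff.1 (Completion.denseRange_coe x) (δ n) (hδ n)
      exact ⟨z, by simpa [a, hn] using hz.le, fun h => absurd h hn⟩
  choose z hz hzp using happrox
  choose f hfc hf0 hf1 hfl using fun n => hX.exists_unitInterval_path (z n) (z (n + 1)) (hδ n)
  have hglue (n : ℕ) : f n 1 = f (n + 1) 0 := by rw [hf1, hf0]
  let b : ℕ → ℝ := fun n => (if n = 0 then dist x p else 0) + 3 * δ n
  have hb (n : ℕ) : 0 ≤ b n := by
    have := hδ n
    dsimp only [b]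
    split_ifs <;> positivity
  have hlen (n : ℕ) : eVariationOn (f n) (Icc 0 1) ≤ ENNReal.ofReal (b n) := by
    refine (hfl n).trans (ENNReal.ofReal_le_ofReal ?_)
    have h1 := hz n
    have h2 := hz (n + 1)
    have h3 := dist_triangle_left (z n : Completion X) (z (n + 1)) x
    rw [Completion.dist_eq] at h3
    simp only [a, b, Nat.add_eq_zero_iff, one_ne_zero, and_false, if_false, hδ_succ] at *
    linarith [hδ n]
  have hlim : Tendsto (fun t => ((concatRay f t : X) : Completion X)) atTop (𝓝 x) := by
    rw [tendsto_iff_dist_tendsto_zero]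
    have hδ_lim : Tendsto (fun t : ℝ => 4 * δ ⌊t⌋₊) atTop (𝓝 0) := by
      have : Tendsto (fun n => 4 * δ n) atTop (𝓝 0) := by
        simpa [δ] using ((tendsto_pow_atTop_nhds_zero_of_lt_one (r := (1 / 2 : ℝ))
          (by norm_num) (by norm_num)).const_mul (ε / 6)).const_mul 4
      exact this.comp tendsto_nat_floor_atTop
    refine squeeze_zero' (Eventually.of_forall fun _ => dist_nonneg) ?_ hδ_lim
    filter_upwards [eventually_ge_atTop 1] with t ht
    set n := ⌊t⌋₊ with hn
    have hn0 : n ≠ 0 := (Nat.floor_pos.2 ht).ne'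
    have hmem : t - n ∈ Icc (0 : ℝ) 1 :=
      ⟨sub_nonneg.2 (Nat.floor_le (zero_le_one.trans ht)), by linarith [Nat.lt_floor_add_one t]⟩
    have h1 : dist (f n (t - n)) (z n) ≤ b n := by
      rw [← hf0 n, ← ENNReal.ofReal_le_ofReal_iff (hb n), ← edist_dist]
      exact (eVariationOn.edist_le _ hmem (by simp)).trans (hlen n)
    have h2 := hz n
    have h3 := dist_triangle_right (f n (t - n) : Completion X) x (z n)
    rw [Completion.dist_eq] at h3
    simp only [a, b, hn0, if_false] at h1 h2
    change dist ((f n (t - n) : X) : Completion X) x ≤ _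
    linarith
  have hL (n : ℕ) : eVariationOn (fun t => ((concatRay f t : X) : Completion X)) (Icc 0 n) ≤
      ENNReal.ofReal (dist x p + ε) := by
    have hcoe : eVariationOn (fun t => ((concatRay f t : X) : Completion X)) (Icc 0 n) =
        eVariationOn (concatRay f) (Icc 0 n) := by
      simp only [eVariationOn, Completion.edist_eq]
    rw [hcoe]
    refine ((concatRay.eVariationOn_le hglue n).trans (Finset.sum_le_sum fun i _ => hlen i)).trans ?_
    rw [← ENNReal.ofReal_sum_of_nonneg fun i _ => hb i]
    refine ENNReal.ofReal_le_ofReal ?_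
    rw [Finset.sum_add_distrib, ← Finset.mul_sum, Finset.sum_ite_eq' (Finset.range n) 0]
    have := hδ_sum n
    split_ifs <;> linarith [dist_nonneg (x := x) (y := (p : Completion X))]
  obtain ⟨g, hgc, hg0, hg1, hgr, hgl⟩ := exists_path_of_ray
    ((Completion.continuous_coe X).comp_continuousOn (concatRay.continuousOn hglue hfc)) hlim hL
  refine ⟨g, hgc, hg0, ?_, fun t ht => ?_, hgl⟩
  · rw [hg1]
    simp [concatRay, hf0, hzp]
  · obtain ⟨s, hs⟩ := hgr t ht
    exact ⟨_, hs⟩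

/-- Lemma 4.2, first claim: any two points of the completion of a length space `X` are joined
by paths with interior in `X` and length arbitrarily close to the distance between them. -/
theorem stmt_12 {X : Type*} [MetricSpace X] (hX : IsLengthSpace X)
    (x y : UniformSpace.Completion X) (ε : ℝ) (hε : 0 < ε) :
    ∃ γ : MPath (UniformSpace.Completion X),
      γ.initial = x ∧ γ.final = y ∧
      (∀ t ∈ Set.Ioo γ.a γ.b,
        γ.toFun t ∈ Set.range ((↑) : X → UniformSpace.Completion X)) ∧
      γ.length < ENNReal.ofReal (dist x y + ε) := by
  have hε' : 0 < ε / 8 := by positivity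
  obtain ⟨p, hp⟩ :=
    Metric.mem_closure_range_iff.1 (UniformSpace.Completion.denseRange_coe x) (ε / 8) hε'
  obtain ⟨g, hgc, hg0, hg1, hgr, hgl⟩ := hX.exists_path_from_completion x p hε'
  obtain ⟨h, hhc, hh0, hh1, hhr, hhl⟩ := hX.exists_path_from_completion y p hε'
  have hmaps : MapsTo (fun t : ℝ => 1 - t) (Icc 0 1) (Icc 0 1) := by
    rintro t ⟨h0, h1⟩
    constructor <;> linarith
  let f : ℕ → ℝ → UniformSpace.Completion X
    | 0 => g
    | 1 => fun t => h (1 - t)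
    | _ + 2 => fun _ => y
  have hglue : ∀ n, f n 1 = f (n + 1) 0
    | 0 => by simp [f, hg1, hh1]
    | 1 => by simp [f, hh0]
    | _ + 2 => rfl
  have hfc : ∀ n, ContinuousOn (f n) (Icc 0 1)
    | 0 => hgc
    | 1 => hhc.comp (by fun_prop) hmaps
    | _ + 2 => continuousOn_const
  refine ⟨⟨0, 2, zero_le_two, concatRay f,
    (concatRay.continuousOn hglue hfc).mono Icc_subset_Ici_self⟩, ?_, ?_, ?_, ?_⟩
  · simp [MPath.initial, concatRay, f, hg0]
  · simp [MPath.final, concatRay, f]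
  · rintro t ⟨h0, h2⟩
    dsimp only at h0 h2 ⊢
    rcases le_total t 1 with h1 | h1
    · rw [concatRay.eqOn hglue 0 ⟨by simpa using h0.le, by simpa using h1⟩]
      exact hgr _ ⟨by simpa using h0, by simpa using h1⟩
    · rw [concatRay.eqOn hglue 1 ⟨by simpa using h1, by norm_num; linarith⟩]
      exact hhr _ ⟨by norm_num; linarith, by norm_num; linarith⟩
  · have hlen := concatRay.eVariationOn_le hglue 2
    have hrev : eVariationOn (f 1) (Icc 0 1) ≤ eVariationOn h (Icc 0 1) :=
      eVariationOn.comp_le_of_antitoneOn h (fun t : ℝ => 1 - t)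
        (fun s _ t _ hst => sub_le_sub_left hst _) hmaps
    rw [Finset.sum_range_succ, Finset.sum_range_one] at hlen
    refine (hlen.trans (add_le_add hgl (hrev.trans hhl))).trans_lt ?_
    rw [← ENNReal.ofReal_add (by positivity) (by positivity)]
    refine (ENNReal.ofReal_lt_ofReal_iff (by positivity)).2 ?_
    linarith [dist_triangle_left y (p : UniformSpace.Completion X) x]
end

section
/- Let X be a length space with metric d and let X̂ be its metric completion. Then the intersection of X with any open ball in X̂ is path-connected. (Lemma 4.2, second claim) -/
open Set Metric
open scoped ENNReal

/-- A point on a path is no farther from the final endpoint than the length of the path. -/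
theorem MPath.edist_final_le_length {X : Type*} [MetricSpace X] (γ : MPath X) {t : ℝ}
    (ht : t ∈ Set.Icc γ.a γ.b) : edist (γ.toFun t) γ.final ≤ γ.length :=
  eVariationOn.edist_le _ ht ⟨γ.hab, le_rfl⟩

/-- A path whose image under a continuous map `f` lies in `S` joins the images of its endpoints
in `S`. -/
theorem MPath.joinedIn {X Y : Type*} [MetricSpace X] [TopologicalSpace Y] (γ : MPath X)
    {f : X → Y} (hf : Continuous f) {S : Set Y}
    (hS : ∀ t ∈ Set.Icc γ.a γ.b, f (γ.toFun t) ∈ S) :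
    JoinedIn S (f γ.initial) (f γ.final) := by
  have hmaps : MapsTo (fun t : ℝ => γ.a + t * (γ.b - γ.a)) unitInterval
      (Set.Icc γ.a γ.b) := by
    rintro t ⟨h0, h1⟩
    have := γ.hab
    constructor <;> nlinarith
  refine JoinedIn.ofLine (f := fun t : ℝ => f (γ.toFun (γ.a + t * (γ.b - γ.a)))) ?_ ?_ ?_ ?_
  · exact hf.comp_continuousOn (γ.cont.comp (by fun_prop) hmaps)
  · simp [MPath.initial]
  · simp [MPath.final]
  · rintro _ ⟨t, ht, rfl⟩
    exact hS _ (hmaps ht)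

/-- In a length space `X`, a point `y` of a ball in the completion can be joined, inside the
ball and inside `X`, to any point of `X` close enough to the center. -/
theorem IsLengthSpace.joinedIn_ball {X : Type*} [MetricSpace X] (hX : IsLengthSpace X)
    {c : UniformSpace.Completion X} {r δ : ℝ} {y p : X}
    (hp : dist c (p : UniformSpace.Completion X) < δ)
    (hy : dist (y : UniformSpace.Completion X) c + 3 * δ ≤ r) :
    JoinedIn (Set.range ((↑) : X → UniformSpace.Completion X) ∩ Metric.ball c r)
      (y : UniformSpace.Completion X) (p : UniformSpace.Completion X) := by
  have hδ : 0 < δ := dist_nonneg.trans_lt hp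
  obtain ⟨γ, rfl, rfl, hlen⟩ := hX y p δ hδ
  refine γ.joinedIn (UniformSpace.Completion.continuous_coe X) fun t ht => ⟨⟨_, rfl⟩, ?_⟩
  have hw : dist (γ.toFun t) γ.final < dist γ.initial γ.final + δ := by
    have h := (γ.edist_final_le_length ht).trans_lt hlen
    rw [edist_dist] at h
    exact (ENNReal.ofReal_lt_ofReal_iff (by positivity)).1 h
  rw [← UniformSpace.Completion.dist_eq (γ.toFun t),
    ← UniformSpace.Completion.dist_eq γ.initial] at hw
  have h1 := dist_triangle (γ.initial : UniformSpace.Completion X) c γ.final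
  have h2 := dist_triangle_right (γ.toFun t : UniformSpace.Completion X) c γ.final
  rw [Metric.mem_ball]
  linarith

/-- Lemma 4.2, second claim: the intersection of a length space `X` with any open ball in its
completion is path-connected. -/
theorem stmt_13 {X : Type*} [MetricSpace X] (hX : IsLengthSpace X)
    (c : UniformSpace.Completion X) (r : ℝ) :
    ∀ y ∈ Set.range ((↑) : X → UniformSpace.Completion X) ∩ Metric.ball c r,
      ∀ z ∈ Set.range ((↑) : X → UniformSpace.Completion X) ∩ Metric.ball c r,
        JoinedIn (Set.range ((↑) : X → UniformSpace.Completion X) ∩ Metric.ball c r) y z := by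
  rintro _ ⟨⟨y, rfl⟩, hy⟩ _ ⟨⟨z, rfl⟩, hz⟩
  rw [Metric.mem_ball] at hy hz
  set m := max (dist (y : UniformSpace.Completion X) c) (dist (z : UniformSpace.Completion X) c)
  have hm : m < r := max_lt hy hz
  have hym : dist (y : UniformSpace.Completion X) c ≤ m := le_max_left _ _
  have hzm : dist (z : UniformSpace.Completion X) c ≤ m := le_max_right _ _
  obtain ⟨p, hp⟩ := UniformSpace.Completion.denseRange_coe.exists_dist_lt c
    (show 0 < (r - m) / 3 by linarith)
  exact (hX.joinedIn_ball hp (by linarith)).trans (hX.joinedIn_ball hp (by linarith)).symm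
end
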